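/- arXiv:2001.09103 — 6 statements merged into one kernel-verified Lean document; each statement's English description precedes it below -/
import Mathlib

section
/- Let ℓ be a positive integer and let n be an integer satisfying n ≥ (2ℓ + 3·C(ℓ−1,2))·C(ℓ−1,2) + ℓ, where C(a,b) denotes the binomial coefficient. Then every partial Steiner triple system on a point set of cardinality n has an ℓ-good sequencing. -/
open Finset

/-- Properties of the block relation `{a, b, c} ∈ B` of a partial Steiner triple system: it is
symmetric, and two of its arguments determine the third. -/
structure IsTripleRel {V : Type} (R : V → V → V → Prop) : Prop where
  swap_left : ∀ {a b c}, R a b c → R b a c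
  swap_right : ∀ {a b c}, R a b c → R a c b
  unique : ∀ {a b x y}, R a b x → R a b y → x = y

/-- `f 0, …, f (m - 1)` is an `ℓ`-good sequence of distinct points. -/
structure IsGoodSeq {V : Type} (R : V → V → V → Prop) (ℓ : ℕ) (f : ℕ → V) (m : ℕ) : Prop where
  inj : ∀ i < m, ∀ j < m, f i = f j → i = j
  good : ∀ i j k, i < j → j < k → k < m → k < i + ℓ → ¬ R (f i) (f j) (f k)

section Thirds

variable {V : Type} [Fintype V] {R : V → V → V → Prop}

open Classical in
/-- The points completing a pair from `P` to a block. -/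
noncomputable def thirds {α : Type} (R : V → V → V → Prop) (P : Finset α) (u v : α → V) :
    Finset V :=
  univ.filter fun x => ∃ p ∈ P, R (u p) (v p) x

lemma mem_thirds {α : Type} {P : Finset α} {u v : α → V} {x : V} :
    x ∈ thirds R P u v ↔ ∃ p ∈ P, R (u p) (v p) x := by
  simp [thirds]

lemma card_thirds_le (hR : IsTripleRel R) {α : Type} (P : Finset α) (u v : α → V) :
    (thirds R P u v).card ≤ P.card := by
  classical
  have hsub : thirds R P u v ⊆ P.biUnion fun p => univ.filter fun x => R (u p) (v p) x := by
    intro x hx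
    simpa [mem_thirds] using hx
  refine (card_le_card hsub).trans ((card_biUnion_le_card_mul _ _ 1 ?_).trans (by simp))
  intro p _
  rw [card_le_one]
  intro x hx y hy
  exact hR.unique (by simpa using hx) (by simpa using hy)

/-- Pairs of positions among the last `ℓ - 1` positions before `m`. -/
def windowPairs (ℓ m : ℕ) : Finset (ℕ × ℕ) :=
  ((Ico (m - (ℓ - 1)) m) ×ˢ (Ico (m - (ℓ - 1)) m)).filter fun p => p.1 < p.2

lemma card_windowPairs_le (ℓ m : ℕ) : (windowPairs ℓ m).card ≤ (ℓ - 1).choose 2 := by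
  set s := Ico (m - (ℓ - 1)) m with hs
  have h1 : (windowPairs ℓ m).card ≤ (s.powersetCard 2).card := by
    refine card_le_card_of_injOn (fun p => {p.1, p.2}) ?_ ?_
    · rintro ⟨a, b⟩ hp
      simp only [windowPairs, ← hs, coe_filter, mem_product, Set.mem_ofPred_eq] at hp
      simp only [mem_coe, mem_powersetCard]
      refine ⟨?_, card_pair hp.2.ne⟩
      intro x hx
      simp only [mem_insert, mem_singleton] at hx
      rcases hx with rfl | rfl
      exacts [hp.1.1, hp.1.2]
    · rintro ⟨a, b⟩ hp ⟨a', b'⟩ hp' h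
      have hab : a < b := (mem_filter.1 hp).2
      have hab' : a' < b' := (mem_filter.1 hp').2
      have h' : ({a, b} : Finset ℕ) = {a', b'} := h
      have ha : a ∈ ({a', b'} : Finset ℕ) := h' ▸ mem_insert_self _ _
      have hb : b ∈ ({a', b'} : Finset ℕ) := h' ▸ by simp
      have ha' : a' ∈ ({a, b} : Finset ℕ) := h' ▸ mem_insert_self _ _
      simp only [mem_insert, mem_singleton] at ha hb ha'
      ext <;> simp only <;> omega
  rw [card_powersetCard] at h1
  refine h1.trans (Nat.choose_le_choose 2 ?_)
  simp only [hs, Nat.card_Ico]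
  omega

/-- The points that may not be placed at position `m`. -/
noncomputable def forbidden (R : V → V → V → Prop) (ℓ : ℕ) (f : ℕ → V) (m : ℕ) : Finset V :=
  thirds R (windowPairs ℓ m) (fun p => f p.1) (fun p => f p.2)

lemma mem_forbidden {ℓ : ℕ} {f : ℕ → V} {m : ℕ} {x : V} :
    x ∈ forbidden R ℓ f m ↔ ∃ i j, i < j ∧ j < m ∧ m < i + ℓ ∧ R (f i) (f j) x := by
  simp only [forbidden, mem_thirds, windowPairs, mem_filter, mem_product, mem_Ico, Prod.exists]
  constructor
  · rintro ⟨i, j, ⟨⟨h1, h2⟩, h3⟩, h⟩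
    exact ⟨i, j, h3, h2.2, by omega, h⟩
  · rintro ⟨i, j, h1, h2, h3, h⟩
    exact ⟨i, j, by omega, h⟩

lemma card_forbidden_le (hR : IsTripleRel R) (ℓ : ℕ) (f : ℕ → V) (m : ℕ) :
    (forbidden R ℓ f m).card ≤ (ℓ - 1).choose 2 :=
  (card_thirds_le hR _ _ _).trans (card_windowPairs_le ℓ m)

end Thirds

lemma image_range_snoc {V : Type} [DecidableEq V] {f : ℕ → V} {m : ℕ} (x : V) :
    (range (m + 1)).image (Function.update f m x) = insert x ((range m).image f) := by
  rw [range_add_one, image_insert, Function.update_self]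
  congr 1
  refine image_congr fun i hi => Function.update_of_ne ?_ _ _
  exact (mem_range.1 hi).ne

lemma image_range_subset {V : Type} [DecidableEq V] {f g : ℕ → V} {m m' : ℕ} (hm : m ≤ m')
    (h : ∀ i < m, g i = f i) :
    (range m).image f ⊆ (range m').image g := by
  intro x hx
  obtain ⟨i, hi, rfl⟩ := mem_image.1 hx
  have hi := mem_range.1 hi
  exact mem_image.2 ⟨i, mem_range.2 (by omega), h i hi⟩

section Greedy

variable {V : Type} [Fintype V] [DecidableEq V] {R : V → V → V → Prop} {ℓ : ℕ}
  {f : ℕ → V} {m : ℕ}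

lemma IsGoodSeq.snoc (hf : IsGoodSeq R ℓ f m) {x : V} (hx : x ∉ (range m).image f)
    (hx' : x ∉ forbidden R ℓ f m) : IsGoodSeq R ℓ (Function.update f m x) (m + 1) := by
  have hlt : ∀ i < m, Function.update f m x i = f i := fun i hi =>
    Function.update_of_ne hi.ne _ _
  have hne : ∀ i < m, f i ≠ x := fun i hi h =>
    hx (mem_image.2 ⟨i, mem_range.2 hi, h⟩)
  constructor
  · intro i hi j hj h
    rcases Nat.lt_succ_iff_lt_or_eq.1 hi with hi | rfl <;>
      rcases Nat.lt_succ_iff_lt_or_eq.1 hj with hj | rfl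
    · rw [hlt i hi, hlt j hj] at h
      exact hf.inj i hi j hj h
    · rw [hlt i hi, Function.update_self] at h
      exact absurd h (hne i hi)
    · rw [hlt j hj, Function.update_self] at h
      exact absurd h.symm (hne j hj)
    · rfl
  · intro i j k hij hjk hk hw h
    rw [hlt i (by omega), hlt j (by omega)] at h
    rcases Nat.lt_succ_iff_lt_or_eq.1 hk with hk | rfl
    · rw [hlt k hk] at h
      exact hf.good i j k hij hjk hk hw h
    · rw [Function.update_self] at h
      exact hx' (mem_forbidden.2 ⟨i, j, hij, hjk, hw, h⟩)

lemma exists_next (hR : IsTripleRel R) (f : ℕ → V) (m : ℕ)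
    (E : Finset V) (hE : m + (ℓ - 1).choose 2 + E.card < Fintype.card V) :
    ∃ x, x ∉ E ∧ x ∉ (range m).image f ∧ x ∉ forbidden R ℓ f m := by
  have h1 : ((range m).image f ∪ forbidden R ℓ f m ∪ E).card < (univ : Finset V).card := by
    have h2 := card_forbidden_le hR ℓ f m
    have h3 : ((range m).image f).card ≤ m := card_image_le.trans (card_range m).le
    have h4 := card_union_le ((range m).image f ∪ forbidden R ℓ f m) E
    have h5 := card_union_le ((range m).image f) (forbidden R ℓ f m)
    rw [card_univ]
    omega
  obtain ⟨x, -, hx⟩ := exists_mem_notMem_of_card_lt_card h1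
  simp only [mem_union, not_or] at hx
  exact ⟨x, hx.2, hx.1.1, hx.1.2⟩

lemma IsGoodSeq.exists_extend (hR : IsTripleRel R) (hf : IsGoodSeq R ℓ f m) (d : ℕ)
    (hd : m + d + (ℓ - 1).choose 2 ≤ Fintype.card V) :
    ∃ g, (∀ i < m, g i = f i) ∧ IsGoodSeq R ℓ g (m + d) := by
  induction d with
  | zero => exact ⟨f, fun _ _ => rfl, hf⟩
  | succ d ih =>
    obtain ⟨g, hgf, hg⟩ := ih (by omega)
    obtain ⟨x, -, hx, hx'⟩ := exists_next (ℓ := ℓ) hR g (m + d) ∅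
      (by rw [card_empty]; omega)
    refine ⟨Function.update g (m + d) x, fun i hi => ?_, hg.snoc hx hx'⟩
    rw [Function.update_of_ne (by omega), hgf i hi]

/-- Any prescribed unused point can be placed after at most `ℓ - 1` suitably chosen points. -/
lemma IsGoodSeq.exists_extend_mem (hR : IsTripleRel R) (hℓ : 0 < ℓ) (hf : IsGoodSeq R ℓ f m)
    {t : V} (ht : t ∉ (range m).image f)
    (hm : m + (ℓ - 1).choose 2 + 2 * ℓ ≤ Fintype.card V) :
    ∃ g, (∀ i < m, g i = f i) ∧ IsGoodSeq R ℓ g (m + ℓ) ∧ t ∈ (range (m + ℓ)).image g := by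
  have key : ∀ d ≤ ℓ - 1, ∃ g, (∀ i < m, g i = f i) ∧ IsGoodSeq R ℓ g (m + d) ∧
      t ∉ (range (m + d)).image g ∧
      ∀ i j, i < j → j < m + d → m ≤ j → j < i + ℓ → ¬ R (g i) (g j) t := by
    intro d
    induction d with
    | zero => exact fun _ => ⟨f, fun _ _ => rfl, hf, ht, fun i j _ h h' => by omega⟩
    | succ d ih =>
      intro hd
      obtain ⟨g, hgf, hg, hgt, hgR⟩ := ih (by omega)
      set E := thirds R (Ico (m + d - (ℓ - 1)) (m + d)) g (fun _ => t) with hEdef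
      have hEcard : (insert t E).card ≤ ℓ := by
        have h1 := card_insert_le t E
        have h2 := card_thirds_le hR (Ico (m + d - (ℓ - 1)) (m + d)) g (fun _ => t)
        rw [Nat.card_Ico, ← hEdef] at h2
        omega
      obtain ⟨x, hxE, hx, hx'⟩ := exists_next (ℓ := ℓ) hR g (m + d) (insert t E)
        (by omega)
      rw [mem_insert, not_or] at hxE
      refine ⟨Function.update g (m + d) x, fun i hi => ?_, hg.snoc hx hx', ?_, ?_⟩
      · rw [Function.update_of_ne (by omega), hgf i hi]
      · rw [← add_assoc, image_range_snoc, mem_insert, not_or]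
        exact ⟨Ne.symm hxE.1, hgt⟩
      · intro i j hij hj hmj hw h
        rw [Function.update_of_ne (by omega)] at h
        rcases Nat.lt_succ_iff_lt_or_eq.1 (show j < m + d + 1 from hj) with hj | rfl
        · rw [Function.update_of_ne (by omega)] at h
          exact hgR i j hij hj hmj hw h
        · rw [Function.update_self] at h
          exact hxE.2 (mem_thirds.2 ⟨i, mem_Ico.2 (by omega), hR.swap_right h⟩)
  obtain ⟨g, hgf, hg, hgt, hgR⟩ := key (ℓ - 1) le_rfl
  have hfor : t ∉ forbidden R ℓ g (m + (ℓ - 1)) := by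
    rw [mem_forbidden]
    rintro ⟨i, j, hij, hj, hw, h⟩
    exact hgR i j hij hj (by omega) (by omega) h
  have hlen : m + ℓ = m + (ℓ - 1) + 1 := by omega
  refine ⟨Function.update g (m + (ℓ - 1)) t, fun i hi => ?_, ?_, ?_⟩
  · rw [Function.update_of_ne (by omega), hgf i hi]
  · rw [hlen]
    exact hg.snoc hgt hfor
  · rw [hlen, image_range_snoc]
    exact mem_insert_self _ _

/-- Points of `T` can be placed consecutively until at most `(ℓ - 1).choose 2` are left. -/
lemma IsGoodSeq.exists_extend_card_sdiff_le (hR : IsTripleRel R) (T : Finset V)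
    (hf : IsGoodSeq R ℓ f m) :
    ∃ g m', m ≤ m' ∧ m' ≤ m + T.card ∧ (∀ i < m, g i = f i) ∧ IsGoodSeq R ℓ g m' ∧
      (T \ (range m').image g).card ≤ (ℓ - 1).choose 2 := by
  suffices H : ∀ k f m, (T \ (range m).image f).card = k → IsGoodSeq R ℓ f m →
      ∃ g m', m ≤ m' ∧ m' ≤ m + k ∧ (∀ i < m, g i = f i) ∧ IsGoodSeq R ℓ g m' ∧
        (T \ (range m').image g).card ≤ (ℓ - 1).choose 2 by
    obtain ⟨g, m', h1, h2, h3⟩ := H _ f m rfl hf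
    exact ⟨g, m', h1, h2.trans (Nat.add_le_add_left (card_le_card sdiff_subset) _), h3⟩
  intro k
  induction k with
  | zero => exact fun f m hk hf => ⟨f, m, le_rfl, le_rfl, fun _ _ => rfl, hf, by omega⟩
  | succ k ih =>
    intro f m hk hf
    by_cases hc : (T \ (range m).image f).card ≤ (ℓ - 1).choose 2
    · exact ⟨f, m, le_rfl, by omega, fun _ _ => rfl, hf, hc⟩
    · obtain ⟨t, ht, ht'⟩ := exists_mem_notMem_of_card_lt_card
        ((card_forbidden_le hR ℓ f m).trans_lt (not_le.1 hc))
      obtain ⟨htT, htf⟩ := mem_sdiff.1 ht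
      obtain ⟨g, m', h1, h2, h3, h4⟩ := ih (Function.update f m t) (m + 1)
        (by rw [image_range_snoc, sdiff_insert, card_erase_of_mem ht, hk]; rfl)
        (hf.snoc htf ht')
      refine ⟨g, m', by omega, by omega, fun i hi => ?_, h4⟩
      rw [h3 i (by omega), Function.update_of_ne (by omega)]

lemma IsGoodSeq.exists_extend_subset (hR : IsTripleRel R) (hℓ : 0 < ℓ) (T : Finset V) (k : ℕ) :
    ∀ f m, (T \ (range m).image f).card ≤ k → IsGoodSeq R ℓ f m →
      m + ℓ * k + (ℓ - 1).choose 2 + ℓ ≤ Fintype.card V →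
      ∃ g m', m ≤ m' ∧ m' ≤ m + ℓ * k ∧ (∀ i < m, g i = f i) ∧ IsGoodSeq R ℓ g m' ∧
        T ⊆ (range m').image g := by
  induction k with
  | zero =>
    intro f m hk hf _
    refine ⟨f, m, le_rfl, by omega, fun _ _ => rfl, hf, ?_⟩
    rw [← sdiff_eq_empty_iff_subset, ← card_eq_zero]
    omega
  | succ k ih =>
    intro f m hk hf hn
    rw [Nat.mul_succ] at hn ⊢
    rcases (T \ (range m).image f).eq_empty_or_nonempty with he | ⟨t, ht⟩
    · exact ⟨f, m, le_rfl, by omega, fun _ _ => rfl, hf, sdiff_eq_empty_iff_subset.1 he⟩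
    · obtain ⟨g, hgf, hg, hgt⟩ := hf.exists_extend_mem hR hℓ (mem_sdiff.1 ht).2 (by omega)
      have hlt : (T \ (range (m + ℓ)).image g).card < (T \ (range m).image f).card := by
        refine card_lt_card ((ssubset_iff_of_subset ?_).2 ⟨t, ht, fun h => (mem_sdiff.1 h).2 hgt⟩)
        exact sdiff_subset_sdiff subset_rfl (image_range_subset (by omega) hgf)
      obtain ⟨g', m', h1, h2, h3, h4⟩ := ih g (m + ℓ) (by omega) hg (by omega)
      refine ⟨g', m', by omega, by omega, fun i hi => ?_, h4⟩
      rw [h3 i (by omega), hgf i hi]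

/-- Pairs `i < j < N` of positions at distance at most `ℓ - 2`. -/
def closePairs (ℓ N : ℕ) : Finset (ℕ × ℕ) :=
  (range N ×ˢ range (ℓ - 2)).image fun p => (p.1 - 1 - p.2, p.1)

lemma card_closePairs_le (ℓ N : ℕ) : (closePairs ℓ N).card ≤ N * (ℓ - 2) := by
  refine card_image_le.trans ?_
  simp

lemma mem_closePairs {ℓ N i j : ℕ} (hij : i < j) (hj : j < N) (h : j + 2 ≤ i + ℓ) :
    (i, j) ∈ closePairs ℓ N := by
  refine mem_image.2 ⟨(j, j - 1 - i), ?_, ?_⟩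
  · simp only [mem_product, mem_range]
    omega
  · ext <;> simp only
    omega

/-- All but `(ℓ - 1).choose 2` points form a good sequence such that no omitted point is in a block
with two points at distance at most `ℓ - 2` near the beginning. -/
lemma exists_isGoodSeq [Nonempty V] (hR : IsTripleRel R) (hℓ : 0 < ℓ)
    (hn : (2 * ℓ + 3 * (ℓ - 1).choose 2) * (ℓ - 1).choose 2 + ℓ ≤ Fintype.card V) :
    ∃ g, IsGoodSeq R ℓ g (Fintype.card V - (ℓ - 1).choose 2) ∧
      ∀ i j x, i < j → j < (ℓ - 1) * (ℓ - 1).choose 2 → j + 2 ≤ i + ℓ → R (g i) (g j) x →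
        x ∈ (range (Fintype.card V - (ℓ - 1).choose 2)).image g := by
  have hc2 : (ℓ - 1) * (ℓ - 2) = 2 * (ℓ - 1).choose 2 := by
    rw [Nat.choose_two_right, Nat.mul_div_cancel' (Nat.even_mul_pred_self _).two_dvd]
    rfl
  set c := (ℓ - 1).choose 2 with hc
  set n := Fintype.card V
  have hexp : (2 * ℓ + 3 * c) * c + ℓ = 2 * (ℓ * c) + 3 * (c * c) + ℓ := by ring
  have hN : (ℓ - 1) * c + c = ℓ * c := by
    obtain ⟨k, rfl⟩ : ∃ k, ℓ = k + 1 := ⟨ℓ - 1, by omega⟩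
    rw [Nat.add_sub_cancel]; ring
  have h0 : IsGoodSeq R ℓ (fun _ => Classical.arbitrary V) 0 :=
    ⟨fun i hi => by omega, fun i j k _ _ hk => by omega⟩
  obtain ⟨f₁, -, h₁⟩ := h0.exists_extend hR ((ℓ - 1) * c) (by omega)
  rw [zero_add] at h₁
  set T := thirds R (closePairs ℓ ((ℓ - 1) * c)) (fun p => f₁ p.1) (fun p => f₁ p.2) with hT
  have hTc : T.card ≤ 2 * (c * c) := by
    refine (card_thirds_le hR _ _ _).trans ((card_closePairs_le _ _).trans (le_of_eq ?_))
    calc (ℓ - 1) * c * (ℓ - 2) = (ℓ - 1) * (ℓ - 2) * c := by ring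
      _ = 2 * (c * c) := by rw [hc2]; ring
  obtain ⟨f₂, m₂, hm₂, hm₂', hf₂, h₂, hT₂⟩ := h₁.exists_extend_card_sdiff_le hR T
  obtain ⟨f₃, m₃, hm₃, hm₃', hf₃, h₃, hT₃⟩ :=
    IsGoodSeq.exists_extend_subset hR hℓ T c f₂ m₂ hT₂ h₂ (by omega)
  obtain ⟨g, hg₃, hg⟩ := h₃.exists_extend hR (n - c - m₃) (by omega)
  rw [show m₃ + (n - c - m₃) = n - c by omega] at hg
  refine ⟨g, hg, fun i j x hij hj hw h => ?_⟩
  have hgf : ∀ i < (ℓ - 1) * c, g i = f₁ i := fun i hi => by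
    rw [hg₃ i (by omega), hf₃ i (by omega), hf₂ i hi]
  rw [hgf i (by omega), hgf j hj] at h
  exact image_range_subset (by omega) hg₃
    (hT₃ (mem_thirds.2 ⟨(i, j), mem_closePairs hij hj hw, h⟩))

end Greedy

section Insertion

/-- Insert new entries into a sequence at the positions `0, ℓ, …, (c - 1) * ℓ`: the index in the
old sequence of the entry now at a position `p` which is not one of these. -/
def oldIndex (ℓ c p : ℕ) : ℕ := if p < ℓ * c then p - p / ℓ - 1 else p - c

/-- The position `p` carries an inserted entry. -/
def IsHole (ℓ c p : ℕ) : Prop := ∃ a < c, p = ℓ * a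

variable {ℓ c : ℕ}

lemma oldIndex_of_lt (hℓ : 0 < ℓ) {a b : ℕ} (ha : a < c) (hb : b + 1 < ℓ) :
    oldIndex ℓ c (ℓ * a + (b + 1)) = (ℓ - 1) * a + b := by
  have h1 : ℓ * a + (b + 1) < ℓ * c := by nlinarith
  have h2 : (ℓ * a + (b + 1)) / ℓ = a := by
    rw [Nat.mul_add_div hℓ, Nat.div_eq_of_lt hb, add_zero]
  have h3 : (ℓ - 1) * a + a = ℓ * a := by
    obtain ⟨k, rfl⟩ : ∃ k, ℓ = k + 1 := ⟨ℓ - 1, by omega⟩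
    rw [Nat.add_sub_cancel]; ring
  rw [oldIndex, if_pos h1, h2]
  omega

lemma exists_of_not_isHole (hℓ : 0 < ℓ) {p : ℕ} (hp : ¬ IsHole ℓ c p) (h : p < ℓ * c) :
    ∃ a b, a < c ∧ b + 1 < ℓ ∧ p = ℓ * a + (b + 1) := by
  have h1 : p / ℓ < c := Nat.div_lt_of_lt_mul h
  have h2 := Nat.div_add_mod p ℓ
  have h3 := Nat.mod_lt p hℓ
  have h4 : p % ℓ ≠ 0 := fun h0 => hp ⟨p / ℓ, h1, by omega⟩
  exact ⟨p / ℓ, p % ℓ - 1, h1, by omega, by omega⟩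

lemma oldIndex_lt (hℓ : 0 < ℓ) {p q : ℕ} (hp : ¬ IsHole ℓ c p) (hq : ¬ IsHole ℓ c q)
    (hpq : p < q) : oldIndex ℓ c p < oldIndex ℓ c q := by
  have h3 : ∀ a, (ℓ - 1) * a + a = ℓ * a := fun a => by
    obtain ⟨k, rfl⟩ : ∃ k, ℓ = k + 1 := ⟨ℓ - 1, by omega⟩
    rw [Nat.add_sub_cancel]; ring
  have hc := h3 c
  have step : ∀ a a', a < a' → (ℓ - 1) * a + (ℓ - 1) ≤ (ℓ - 1) * a' := fun a a' h => by
    calc (ℓ - 1) * a + (ℓ - 1) = (ℓ - 1) * (a + 1) := by ring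
      _ ≤ _ := Nat.mul_le_mul_left _ h
  by_cases h2 : q < ℓ * c
  · obtain ⟨a, b, ha, hb, rfl⟩ := exists_of_not_isHole hℓ hp (hpq.trans h2)
    obtain ⟨a', b', ha', hb', rfl⟩ := exists_of_not_isHole hℓ hq h2
    rw [oldIndex_of_lt hℓ ha hb, oldIndex_of_lt hℓ ha' hb']
    rcases lt_trichotomy a a' with h | rfl | h
    · have := step a a' h
      omega
    · omega
    · have := step a' a h
      have := h3 a
      have := h3 a'
      omega
  · have hq' : oldIndex ℓ c q = q - c := if_neg h2
    by_cases h1 : p < ℓ * c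
    · obtain ⟨a, b, ha, hb, rfl⟩ := exists_of_not_isHole hℓ hp h1
      rw [oldIndex_of_lt hℓ ha hb, hq']
      have := step a c ha
      omega
    · have hp' : oldIndex ℓ c p = p - c := if_neg h1
      omega

lemma oldIndex_le (hℓ : 0 < ℓ) {p q : ℕ} (hpq : p ≤ q) :
    oldIndex ℓ c q + p ≤ oldIndex ℓ c p + q := by
  have hle : ∀ p, p < ℓ * c → p / ℓ < c := fun p h => Nat.div_lt_of_lt_mul h
  have hd := Nat.div_le_div_right (c := ℓ) hpq
  have hc : c ≤ ℓ * c := Nat.le_mul_of_pos_left c hℓ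
  have h1 := hle p
  have h2 := hle q
  unfold oldIndex
  split_ifs <;> omega

lemma oldIndex_near_hole (hℓ : 0 < ℓ) {a p : ℕ} (ha : a < c) (hne : p ≠ ℓ * a)
    (h1 : p < ℓ * a + ℓ) (h2 : ℓ * a < p + ℓ) :
    ¬ IsHole ℓ c p ∧ oldIndex ℓ c p < (ℓ - 1) * c ∧
      (p < ℓ * a → oldIndex ℓ c p + ℓ * a = (ℓ - 1) * a + p) ∧
      (ℓ * a < p → oldIndex ℓ c p + 1 + ℓ * a = (ℓ - 1) * a + p) := by
  have step : ∀ a a', a < a' → (ℓ - 1) * a + (ℓ - 1) ≤ (ℓ - 1) * a' := fun a a' h => by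
    calc (ℓ - 1) * a + (ℓ - 1) = (ℓ - 1) * (a + 1) := by ring
      _ ≤ _ := Nat.mul_le_mul_left _ h
  refine ⟨?_, ?_⟩
  · rintro ⟨a', -, rfl⟩
    have e1 : a' < a + 1 := by
      by_contra h
      have := Nat.mul_le_mul_left ℓ (not_lt.1 h)
      rw [Nat.mul_succ] at this
      omega
    have e2 : a < a' + 1 := by
      by_contra h
      have := Nat.mul_le_mul_left ℓ (not_lt.1 h)
      rw [Nat.mul_succ] at this
      omega
    exact hne (by rw [show a' = a by omega])
  · rcases lt_or_gt_of_ne hne with h | h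
    · obtain ⟨a, rfl⟩ : ∃ a', a = a' + 1 :=
        ⟨a - 1, by rcases a with _ | a <;> simp_all⟩
      rw [Nat.mul_succ] at h h2
      obtain ⟨b, rfl⟩ : ∃ b, p = ℓ * a + (b + 1) := ⟨p - ℓ * a - 1, by omega⟩
      rw [oldIndex_of_lt hℓ (by omega) (by omega)]
      have := step a c (by omega)
      rw [Nat.mul_succ, Nat.mul_succ]
      refine ⟨by omega, fun _ => by omega, fun _ => by omega⟩
    · obtain ⟨b, rfl⟩ : ∃ b, p = ℓ * a + (b + 1) := ⟨p - ℓ * a - 1, by omega⟩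
      rw [oldIndex_of_lt hℓ ha (by omega)]
      have := step a c ha
      refine ⟨by omega, fun _ => by omega, fun _ => by omega⟩

open Classical in
/-- The sequence `g` with the entries of `u` inserted. -/
noncomputable def insertSeq {V : Type} (ℓ c : ℕ) (u g : ℕ → V) (p : ℕ) : V :=
  if IsHole ℓ c p then u (p / ℓ) else g (oldIndex ℓ c p)

variable {V : Type} {R : V → V → V → Prop} {u g : ℕ → V} {n : ℕ}

lemma insertSeq_hole (hℓ : 0 < ℓ) {a : ℕ} (ha : a < c) : insertSeq ℓ c u g (ℓ * a) = u a := by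
  rw [insertSeq, if_pos ⟨a, ha, rfl⟩, Nat.mul_div_cancel_left _ hℓ]

lemma insertSeq_of_not_isHole {p : ℕ} (hp : ¬ IsHole ℓ c p) :
    insertSeq ℓ c u g p = g (oldIndex ℓ c p) := if_neg hp

lemma oldIndex_lt_sub (hℓ : 0 < ℓ) (hn : ℓ * c ≤ n) {p : ℕ} (hp : ¬ IsHole ℓ c p) (hpn : p < n) :
    oldIndex ℓ c p < n - c := by
  have hnot : ¬ IsHole ℓ c n := by
    rintro ⟨a, ha, rfl⟩
    exact absurd (Nat.le_of_mul_le_mul_left hn hℓ) (by omega)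
  have h := oldIndex_lt hℓ hp hnot hpn
  rwa [oldIndex, oldIndex, if_neg (not_lt.2 hn), ← oldIndex] at h

/-- Inserting points which are in no block with two nearby old points keeps a sequence good. -/
lemma IsGoodSeq.insertSeq (hR : IsTripleRel R) (hℓ : 0 < ℓ) (hn : ℓ * c ≤ n)
    (hg : IsGoodSeq R ℓ g (n - c))
    (hu : ∀ i < c, ∀ j < c, u i = u j → i = j)
    (hug : ∀ i < c, ∀ j < n - c, u i ≠ g j)
    (hT : ∀ i j a, i < j → j < (ℓ - 1) * c → j + 2 ≤ i + ℓ → a < c → ¬ R (g i) (g j) (u a)) :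
    IsGoodSeq R ℓ (insertSeq ℓ c u g) n := by
  have hT' : ∀ a p q, a < c → p ≠ ℓ * a → q ≠ ℓ * a → p < q →
      q < ℓ * a + ℓ → ℓ * a < p + ℓ → q < p + ℓ →
      ¬ R (_root_.insertSeq ℓ c u g p) (_root_.insertSeq ℓ c u g q)
        (_root_.insertSeq ℓ c u g (ℓ * a)) := by
    intro a p q ha hp hq hpq h1 h2 h3
    obtain ⟨p1, p2, p3, p4⟩ := oldIndex_near_hole hℓ ha hp (by omega) h2
    obtain ⟨q1, q2, q3, q4⟩ := oldIndex_near_hole hℓ ha hq h1 (by omega)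
    rw [insertSeq_of_not_isHole p1, insertSeq_of_not_isHole q1, insertSeq_hole hℓ ha]
    exact hT _ _ a (oldIndex_lt hℓ p1 q1 hpq) q2 (by omega) ha
  constructor
  · intro p hp q hq h
    by_cases h1 : IsHole ℓ c p <;> by_cases h2 : IsHole ℓ c q
    · obtain ⟨a, ha, rfl⟩ := h1
      obtain ⟨b, hb, rfl⟩ := h2
      rw [insertSeq_hole hℓ ha, insertSeq_hole hℓ hb] at h
      rw [hu a ha b hb h]
    · obtain ⟨a, ha, rfl⟩ := h1
      rw [insertSeq_hole hℓ ha, insertSeq_of_not_isHole h2] at h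
      exact absurd h (hug a ha _ (oldIndex_lt_sub hℓ hn h2 hq))
    · obtain ⟨b, hb, rfl⟩ := h2
      rw [insertSeq_hole hℓ hb, insertSeq_of_not_isHole h1] at h
      exact absurd h.symm (hug b hb _ (oldIndex_lt_sub hℓ hn h1 hp))
    · rw [insertSeq_of_not_isHole h1, insertSeq_of_not_isHole h2] at h
      have h3 := hg.inj _ (oldIndex_lt_sub hℓ hn h1 hp) _ (oldIndex_lt_sub hℓ hn h2 hq) h
      rcases lt_trichotomy p q with h4 | h4 | h4
      · exact absurd h3 (oldIndex_lt hℓ h1 h2 h4).ne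
      · exact h4
      · exact absurd h3.symm (oldIndex_lt hℓ h2 h1 h4).ne
  · intro i j k hij hjk hk hw h
    by_cases h1 : IsHole ℓ c i
    · obtain ⟨a, ha, rfl⟩ := h1
      exact hT' a j k ha (by omega) (by omega) hjk (by omega) (by omega) (by omega)
        (hR.swap_right (hR.swap_left h))
    by_cases h2 : IsHole ℓ c j
    · obtain ⟨a, ha, rfl⟩ := h2
      exact hT' a i k ha (by omega) (by omega) (by omega) (by omega) (by omega) (by omega)
        (hR.swap_right h)
    by_cases h3 : IsHole ℓ c k
    · obtain ⟨a, ha, rfl⟩ := h3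
      exact hT' a i j ha (by omega) (by omega) hij (by omega) (by omega) (by omega) h
    rw [insertSeq_of_not_isHole h1, insertSeq_of_not_isHole h2, insertSeq_of_not_isHole h3] at h
    have h4 := oldIndex_le (c := c) hℓ (hij.trans hjk).le
    exact hg.good _ _ _ (oldIndex_lt hℓ h1 h2 hij) (oldIndex_lt hℓ h2 h3 hjk)
      (oldIndex_lt_sub hℓ hn h3 hk) (by omega) h

end Insertion

/-- Every sufficiently large triple relation admits a good sequence through all points. -/
lemma exists_isGoodSeq_card {V : Type} [Fintype V] [DecidableEq V] [Nonempty V]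
    {R : V → V → V → Prop} {ℓ : ℕ} (hR : IsTripleRel R) (hℓ : 0 < ℓ)
    (hn : (2 * ℓ + 3 * (ℓ - 1).choose 2) * (ℓ - 1).choose 2 + ℓ ≤ Fintype.card V) :
    ∃ h, IsGoodSeq R ℓ h (Fintype.card V) := by
  obtain ⟨g, hg, hT⟩ := exists_isGoodSeq hR hℓ hn
  set c := (ℓ - 1).choose 2
  set n := Fintype.card V with hnV
  have hexp : (2 * ℓ + 3 * c) * c + ℓ = 2 * (ℓ * c) + 3 * (c * c) + ℓ := by ring
  have hcl : c ≤ ℓ * c := Nat.le_mul_of_pos_left c hℓ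
  have hcard : ((range (n - c)).image g).card = n - c := by
    rw [card_image_of_injOn, card_range]
    intro i hi j hj h
    exact hg.inj i (by simpa using hi) j (by simpa using hj) h
  have hU : (((range (n - c)).image g)ᶜ).card = c := by
    rw [card_compl, hcard, ← hnV]
    omega
  let e := (((range (n - c)).image g)ᶜ).equivFinOfCardEq hU
  let u : ℕ → V := fun i => if h : i < c then (e.symm ⟨i, h⟩ : V) else Classical.arbitrary V
  have hu : ∀ i (h : i < c), u i = e.symm ⟨i, h⟩ := fun i h => dif_pos h
  have hu' : ∀ i < c, u i ∉ (range (n - c)).image g := fun i h => by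
    rw [hu i h]
    exact mem_compl.1 (e.symm ⟨i, h⟩).2
  refine ⟨insertSeq ℓ c u g, hg.insertSeq hR hℓ (by omega) ?_ ?_ ?_⟩
  · intro i hi j hj h
    rw [hu i hi, hu j hj] at h
    simpa using e.symm.injective (Subtype.ext h)
  · intro i hi j hj h
    exact hu' i hi (mem_image.2 ⟨j, mem_range.2 hj, h.symm⟩)
  · intro i j a hij hj hw ha h
    exact hu' a ha (hT i j _ hij hj hw h)

lemma isTripleRel_of_blocks {V : Type} [DecidableEq V] {B : Set (Finset V)}
    (hcard : ∀ b ∈ B, b.card = 3)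
    (hint : ∀ b ∈ B, ∀ b' ∈ B, b ≠ b' → (b ∩ b').card ≤ 1) :
    IsTripleRel fun a b c => ({a, b, c} : Finset V) ∈ B where
  swap_left h := by rwa [insert_comm]
  swap_right {a b c} h := by rwa [pair_comm c b]
  unique {a b x y} hx hy := by
    have hab : a ≠ b := by
      rintro rfl
      have h1 := hcard _ hx
      have h2 : ({a, a, x} : Finset V).card ≤ 2 := by
        rw [insert_eq_of_mem (mem_insert_self a {x})]
        exact card_le_two
      omega
    have hxn : x ∉ ({a, b} : Finset V) := by
      intro hxm
      have h1 := hcard _ hx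
      have h2 : ({a, b, x} : Finset V) ⊆ {a, b} := by
        intro z hz
        simp only [mem_insert, mem_singleton] at hz hxm ⊢
        grind
      have h3 := card_le_card h2
      have h4 : ({a, b} : Finset V).card ≤ 2 := card_le_two
      omega
    by_contra hxy
    have hne : ({a, b, x} : Finset V) ≠ {a, b, y} := by
      intro h
      have h1 : x ∈ ({a, b, y} : Finset V) := h ▸ by simp
      simp only [mem_insert, mem_singleton] at h1 hxn
      tauto
    have h1 := hint _ hx _ hy hne
    have h2 : ({a, b} : Finset V) ⊆ {a, b, x} ∩ {a, b, y} := by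
      intro z hz
      simp only [mem_inter, mem_insert, mem_singleton] at hz ⊢
      tauto
    have h3 := card_le_card h2
    rw [card_pair hab] at h3
    omega

/-- The goodness condition for positions in arbitrary order. -/
lemma IsGoodSeq.not_rel {V : Type} {R : V → V → V → Prop} (hR : IsTripleRel R) {ℓ m : ℕ}
    {f : ℕ → V} (hf : IsGoodSeq R ℓ f m) {s i j k : ℕ} (hi : s ≤ i) (hj : s ≤ j) (hk : s ≤ k)
    (hi' : i < s + ℓ) (hj' : j < s + ℓ) (hk' : k < s + ℓ) (him : i < m) (hjm : j < m) (hkm : k < m)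
    (hij : i ≠ j) (hik : i ≠ k) (hjk : j ≠ k) : ¬ R (f i) (f j) (f k) := by
  intro h
  have l := @hR.swap_left
  have r := @hR.swap_right
  rcases lt_or_gt_of_ne hij with h1 | h1 <;> rcases lt_or_gt_of_ne hik with h2 | h2 <;>
    rcases lt_or_gt_of_ne hjk with h3 | h3
  · exact hf.good i j k h1 h3 hkm (by omega) h
  · exact hf.good i k j h2 h3 hjm (by omega) (r h)
  · omega
  · exact hf.good k i j h2 h1 hjm (by omega) (l (r h))
  · exact hf.good j i k h1 h2 hkm (by omega) (l h)
  · omega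
  · exact hf.good j k i h3 h2 him (by omega) (r (l h))
  · exact hf.good k j i h3 h1 him (by omega) (l (r (l h)))

/-- Every partial Steiner triple system on `n` points with
`n ≥ (2ℓ + 3·C(ℓ−1,2))·C(ℓ−1,2) + ℓ` has an `ℓ`-good sequencing. -/
theorem stmt_0 (ℓ : ℕ) (hℓ : 0 < ℓ) (n : ℕ)
    (hn : n ≥ (2 * ℓ + 3 * Nat.choose (ℓ - 1) 2) * Nat.choose (ℓ - 1) 2 + ℓ)
    (V : Type) [Fintype V] [DecidableEq V] (hV : Fintype.card V = n)
    (B : Set (Finset V))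
    (hcard : ∀ b ∈ B, b.card = 3)
    (hint : ∀ b ∈ B, ∀ b' ∈ B, b ≠ b' → (b ∩ b').card ≤ 1) :
    ∃ xs : List V, xs.Nodup ∧ (∀ v : V, v ∈ xs) ∧
      ∀ i m : ℕ, m ≤ ℓ → ∀ b ∈ B, ¬ (∀ v ∈ b, v ∈ (xs.drop i).take m) := by
  subst hV
  have : Nonempty V := Fintype.card_pos_iff.1 (by omega)
  have hR := isTripleRel_of_blocks hcard hint
  obtain ⟨h, hh⟩ := exists_isGoodSeq_card hR hℓ hn
  have hnodup : ((List.range (Fintype.card V)).map h).Nodup := by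
    refine List.Nodup.map_on ?_ List.nodup_range
    intro i hi j hj
    exact hh.inj i (List.mem_range.1 hi) j (List.mem_range.1 hj)
  refine ⟨(List.range (Fintype.card V)).map h, hnodup, ?_, ?_⟩
  · have huniv : ((List.range (Fintype.card V)).map h).toFinset = univ := by
      rw [← card_eq_iff_eq_univ, List.toFinset_card_of_nodup hnodup]
      simp
    intro v
    rw [← List.mem_toFinset, huniv]
    exact mem_univ v
  · intro s m hm b hb hall
    have hpos : ∀ v ∈ b, ∃ p, s ≤ p ∧ p < s + ℓ ∧ p < Fintype.card V ∧ h p = v := by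
      intro v hv
      obtain ⟨p, hp, rfl⟩ := List.mem_iff_getElem.1 (hall v hv)
      simp only [List.length_take, List.length_drop, List.length_map, List.length_range] at hp
      exact ⟨s + p, by omega, by omega, by omega, by simp⟩
    obtain ⟨x, y, z, hxy, hxz, hyz, rfl⟩ := card_eq_three.1 (hcard b hb)
    obtain ⟨i, hi, hi', him, rfl⟩ := hpos x (by simp)
    obtain ⟨j, hj, hj', hjm, rfl⟩ := hpos y (by simp)
    obtain ⟨k, hk, hk', hkm, rfl⟩ := hpos z (by simp)
    exact hh.not_rel hR hi hj hk hi' hj' hk' him hjm hkm (fun e => hxy (e ▸ rfl))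
      (fun e => hxz (e ▸ rfl)) (fun e => hyz (e ▸ rfl)) hb
end

section
/- There exists a real constant C > 0 such that for every positive integer ℓ and every integer n with n ≥ ℓ⁴/2 + C·ℓ³, every partial Steiner triple system on a point set of cardinality n has an ℓ-good sequencing. -/
section

open Finset

/-- A symmetric ternary relation in which any two entries determine the third. -/
structure IsTripleRelation {V : Type} (R : V → V → V → Prop) : Prop where
  swap_left : ∀ {a b c}, R a b c → R b a c
  swap_right : ∀ {a b c}, R a b c → R a c b
  unique : ∀ {a b c d}, R a c d → R b c d → a = b

/-- The first `N` values of `g` are distinct, and no three of them that are related lie within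
`ℓ` consecutive positions. -/
def IsGoodPrefix {V : Type} (R : V → V → V → Prop) (ℓ N : ℕ) (g : ℕ → V) : Prop :=
  Set.InjOn g (Set.Iio N) ∧
    ∀ i j k, i < j → j < k → k < N → R (g k) (g i) (g j) → i + ℓ ≤ k

variable {V : Type} {R : V → V → V → Prop} {ℓ : ℕ}

lemma IsGoodPrefix.congr {N : ℕ} {g g' : ℕ → V} (h : IsGoodPrefix R ℓ N g)
    (hg : ∀ i < N, g' i = g i) : IsGoodPrefix R ℓ N g' := by
  refine ⟨fun i hi j hj hij => h.1 hi hj ?_, fun i j k hij hjk hk hr => h.2 i j k hij hjk hk ?_⟩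
  · rwa [hg i hi, hg j hj] at hij
  · rwa [hg k hk, hg i (by omega), hg j (by omega)] at hr

lemma IsGoodPrefix.update {N : ℕ} {g : ℕ → V} (h : IsGoodPrefix R ℓ N g) {x : V}
    (hx : ∀ i < N, g i ≠ x) (hr : ∀ i j, i < j → j < N → R x (g i) (g j) → i + ℓ ≤ N) :
    IsGoodPrefix R ℓ (N + 1) (Function.update g N x) := by
  have hlt : ∀ i < N, Function.update g N x i = g i := fun i hi =>
    Function.update_of_ne hi.ne _ _
  have hN : Function.update g N x N = x := Function.update_self _ _ _
  have h' := h.congr hlt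
  refine ⟨fun i hi j hj hij => ?_, fun i j k hij hjk hk hR => ?_⟩
  · simp only [Set.mem_Iio] at hi hj
    rcases Nat.lt_succ_iff_lt_or_eq.1 hi with hi | rfl <;>
      rcases Nat.lt_succ_iff_lt_or_eq.1 hj with hj | rfl
    · exact h'.1 hi hj hij
    · rw [hN, hlt i hi] at hij
      exact absurd hij (hx i hi)
    · rw [hN, hlt j hj] at hij
      exact absurd hij.symm (hx j hj)
    · rfl
  · rcases Nat.lt_succ_iff_lt_or_eq.1 hk with hk | rfl
    · exact h'.2 i j k hij hjk hk hR
    · rw [hN, hlt i (by omega), hlt j hjk] at hR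
      exact hr i j hij hjk hR

/-- The point `r` cannot be inserted between the `c`-th and the next group of `ℓ` entries of `g`
without risk, since it forms a triple with two of these entries. -/
def IsBlockedAt (R : V → V → V → Prop) (ℓ : ℕ) (g : ℕ → V) (r : V) (c : ℕ) : Prop :=
  ∃ i ∈ Ico (c * ℓ) ((c + 2) * ℓ), ∃ j ∈ Ico (c * ℓ) ((c + 2) * ℓ), R r (g i) (g j)

open Classical in
/-- Points that are each free at `t` or more gaps can be assigned pairwise distinct free gaps,
provided there are at most `t` of them. -/
lemma exists_free_gaps (g : ℕ → V) {t : ℕ} (L : Finset V) (hL : #L ≤ t)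
    (hfree : ∀ r ∈ L, t ≤ #{c ∈ range (2 * t) | ¬ IsBlockedAt R ℓ g r c}) :
    ∃ gap : V → ℕ, Set.InjOn gap L ∧
      ∀ r ∈ L, gap r < 2 * t ∧ ¬ IsBlockedAt R ℓ g r (gap r) := by
  have hall : ∀ s : Finset L, #s ≤ #(s.biUnion fun r : L =>
      {c ∈ range (2 * t) | ¬ IsBlockedAt R ℓ g r c}) := by
    intro s
    rcases s.eq_empty_or_nonempty with rfl | ⟨r, hr⟩
    · simp
    · calc #s ≤ Fintype.card L := card_le_univ s
        _ ≤ t := by simpa using hL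
        _ ≤ _ := hfree r r.2
        _ ≤ _ := card_le_card (subset_biUnion_of_mem
            (fun r : L => {c ∈ range (2 * t) | ¬ IsBlockedAt R ℓ g r c}) hr)
  obtain ⟨φ, hφ, hφ'⟩ := (all_card_le_biUnion_card_iff_exists_injective _).1 hall
  refine ⟨fun v => if h : v ∈ L then φ ⟨v, h⟩ else 0, fun a ha b hb hab => ?_, fun r hr => ?_⟩
  · rw [mem_coe] at ha hb
    simp only [ha, hb, dif_pos] at hab
    exact congrArg Subtype.val (hφ hab)
  · simp only [hr, dif_pos]
    simpa using hφ' ⟨r, hr⟩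

variable [Fintype V] [DecidableEq V]

open Classical in
lemma IsTripleRelation.card_third_points_le (hR : IsTripleRelation R) (S : Finset (V × V)) :
    #{x : V | ∃ p ∈ S, R x p.1 p.2} ≤ #S := by
  have hsub : ({x : V | ∃ p ∈ S, R x p.1 p.2} : Finset V) ⊆
      S.biUnion fun p => {x : V | R x p.1 p.2} := by
    intro x hx
    simpa using hx
  calc _ ≤ _ := card_le_card hsub
    _ ≤ #S * 1 := card_biUnion_le_card_mul _ _ _ fun p _ =>
        card_le_one.2 fun a ha b hb => hR.unique (by simpa using ha) (by simpa using hb)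
    _ = #S := mul_one _

lemma IsGoodPrefix.exists_update (hR : IsTripleRelation R) {N : ℕ} {g : ℕ → V}
    (h : IsGoodPrefix R ℓ N g) (F : Finset V) (hF : N + ℓ ^ 2 + #F < Fintype.card V) :
    ∃ x ∉ F, (∀ i < N, g i ≠ x) ∧ IsGoodPrefix R ℓ (N + 1) (Function.update g N x) := by
  classical
  set I : Finset ℕ := Ico (N - ℓ) N
  set W : Finset V := I.image g
  set T : Finset V := {x : V | ∃ p ∈ W ×ˢ W, R x p.1 p.2}
  have hI : #I ≤ ℓ := by simp [I]; omega
  have hW : #W ≤ ℓ := card_image_le.trans hI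
  have hT : #T ≤ ℓ ^ 2 := by
    refine (hR.card_third_points_le _).trans ?_
    rw [card_product, sq]
    exact Nat.mul_le_mul hW hW
  have hcard : #((range N).image g ∪ T ∪ F) < #(univ : Finset V) := by
    have h1 := card_union_le ((range N).image g ∪ T) F
    have h2 := card_union_le ((range N).image g) T
    have h3 : #((range N).image g) ≤ N := card_image_le.trans (card_range N).le
    rw [card_univ]
    omega
  obtain ⟨x, -, hx⟩ := exists_mem_notMem_of_card_lt_card hcard
  simp only [mem_union, not_or] at hx
  have hxN : ∀ i < N, g i ≠ x := fun i hi he =>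
    hx.1.1 (mem_image.2 ⟨i, mem_range.2 hi, he⟩)
  refine ⟨x, hx.2, hxN, h.update hxN fun i j hij hj hr => ?_⟩
  by_contra hlt
  refine hx.1.2 (mem_filter.2 ⟨mem_univ _, (g i, g j), mem_product.2 ⟨?_, ?_⟩, hr⟩) <;>
    refine mem_image_of_mem _ (mem_Ico.2 ?_) <;> omega

lemma IsGoodPrefix.exists_extend (hR : IsTripleRelation R) {N : ℕ} {g : ℕ → V}
    (h : IsGoodPrefix R ℓ N g) (k : ℕ) (hk : N + k + ℓ ^ 2 ≤ Fintype.card V) :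
    ∃ g' : ℕ → V, (∀ i < N, g' i = g i) ∧ IsGoodPrefix R ℓ (N + k) g' := by
  induction k with
  | zero => exact ⟨g, fun _ _ => rfl, h⟩
  | succ k ih =>
    obtain ⟨g', hg, hg'⟩ := ih (by omega)
    obtain ⟨x, -, -, hx⟩ := hg'.exists_update hR ∅ (by simp; omega)
    refine ⟨_, fun i hi => ?_, hx⟩
    rw [Function.update_of_ne (by omega), hg i hi]

/-- A good prefix can be continued by `k` points none of which form a triple with one another
and a given unused point `d`. -/
lemma IsGoodPrefix.exists_extend_avoiding (hR : IsTripleRelation R) {N : ℕ} {g : ℕ → V}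
    (h : IsGoodPrefix R ℓ N g) {d : V} (hd : ∀ i < N, g i ≠ d) (k : ℕ) (hkℓ : k ≤ ℓ)
    (hk : N + k + (ℓ ^ 2 + ℓ + 1) ≤ Fintype.card V) :
    ∃ g' : ℕ → V, (∀ i < N, g' i = g i) ∧ IsGoodPrefix R ℓ (N + k) g' ∧
      (∀ i < N + k, g' i ≠ d) ∧
      ∀ i j, N ≤ i → i < j → j < N + k → ¬ R d (g' i) (g' j) := by
  classical
  induction k with
  | zero => exact ⟨g, fun _ _ => rfl, h, hd, fun i j _ _ _ => by omega⟩
  | succ k ih =>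
    obtain ⟨g', hg, hg', hd', havoid⟩ := ih (by omega) (by omega)
    set S : Finset (V × V) := (Ico N (N + k)).image fun i => (d, g' i)
    set T : Finset V := {x : V | ∃ p ∈ S, R x p.1 p.2}
    have hT : #T ≤ k := (hR.card_third_points_le S).trans (card_image_le.trans (by simp))
    have hins : #(insert d T) ≤ k + 1 := (card_insert_le _ _).trans (by omega)
    obtain ⟨x, hxF, hxN, hx⟩ := hg'.exists_update hR (insert d T) (by omega)
    simp only [mem_insert, not_or] at hxF
    have hlt : ∀ i < N + k, Function.update g' (N + k) x i = g' i := fun i hi =>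
      Function.update_of_ne hi.ne _ _
    have hN : Function.update g' (N + k) x (N + k) = x := Function.update_self _ _ _
    refine ⟨_, fun i hi => ?_, hx, fun i hi => ?_, fun i j hi hij hj hr => ?_⟩
    · rw [hlt i (by omega), hg i hi]
    · rcases Nat.lt_succ_iff_lt_or_eq.1 (show i < N + k + 1 from hi) with hi | rfl
      · rw [hlt i hi]
        exact hd' i hi
      · rw [hN]
        exact hxF.1
    · rcases Nat.lt_succ_iff_lt_or_eq.1 (show j < N + k + 1 from hj) with hj | rfl
      · rw [hlt i (by omega), hlt j hj] at hr
        exact havoid i j hi hij hj hr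
      · rw [hN, hlt i hij] at hr
        refine hxF.2 (mem_filter.2 ⟨mem_univ _, (d, g' i), ?_, ?_⟩)
        · exact mem_image.2 ⟨i, mem_Ico.2 ⟨hi, hij⟩, rfl⟩
        · exact hR.swap_left (hR.swap_right hr)

/-- A good prefix can be continued so as to use a given point. -/
lemma IsGoodPrefix.exists_extend_mem (hR : IsTripleRelation R) {N : ℕ} {g : ℕ → V}
    (h : IsGoodPrefix R ℓ N g) (d : V)
    (hk : N + (ℓ + 1) + (ℓ ^ 2 + ℓ + 1) ≤ Fintype.card V) :
    ∃ (N' : ℕ) (g' : ℕ → V), N ≤ N' ∧ N' ≤ N + (ℓ + 1) ∧ (∀ i < N, g' i = g i) ∧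
      IsGoodPrefix R ℓ N' g' ∧ ∃ i < N', g' i = d := by
  by_cases hd : ∃ i < N, g i = d
  · exact ⟨N, g, le_rfl, by omega, fun _ _ => rfl, h, hd⟩
  · push Not at hd
    obtain ⟨g', hg, hg', hd', havoid⟩ :=
      h.exists_extend_avoiding hR hd ℓ le_rfl (by omega)
    refine ⟨N + ℓ + 1, Function.update g' (N + ℓ) d, by omega, by omega, fun i hi => ?_,
      hg'.update hd' fun i j hij hj hr => ?_, N + ℓ, by omega, Function.update_self _ _ _⟩
    · rw [Function.update_of_ne (by omega), hg i hi]
    · by_contra hlt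
      exact havoid i j (by omega) hij hj hr

lemma IsGoodPrefix.exists_extend_subset (hR : IsTripleRelation R) {N : ℕ} {g : ℕ → V}
    (h : IsGoodPrefix R ℓ N g) (D : Finset V)
    (hk : N + #D * (ℓ + 1) + (ℓ ^ 2 + ℓ + 1) ≤ Fintype.card V) :
    ∃ (N' : ℕ) (g' : ℕ → V), N ≤ N' ∧ N' ≤ N + #D * (ℓ + 1) ∧ (∀ i < N, g' i = g i) ∧
      IsGoodPrefix R ℓ N' g' ∧ ∀ d ∈ D, ∃ i < N', g' i = d := by
  induction D using Finset.induction_on with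
  | empty => exact ⟨N, g, le_rfl, by simp, fun _ _ => rfl, h, by simp⟩
  | insert d D hdD ih =>
    rw [card_insert_of_notMem hdD, add_mul, one_mul] at hk
    obtain ⟨N₁, g₁, hN₁, hN₁', hg₁, hgood₁, hD₁⟩ := ih (by omega)
    obtain ⟨N₂, g₂, hN₂, hN₂', hg₂, hgood₂, hd₂⟩ := hgood₁.exists_extend_mem hR d (by omega)
    refine ⟨N₂, g₂, by omega, ?_, fun i hi => ?_, hgood₂, fun e he => ?_⟩
    · rw [card_insert_of_notMem hdD, add_mul, one_mul]
      omega
    · rw [hg₂ i (by omega), hg₁ i hi]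
    · rcases mem_insert.1 he with rfl | he
      · exact hd₂
      · obtain ⟨i, hi, rfl⟩ := hD₁ e he
        exact ⟨i, by omega, hg₂ i hi⟩

open Classical in
/-- Few points are blocked at more than `t` of the first `2 * t` gaps. -/
lemma IsTripleRelation.card_mostly_blocked_le (hR : IsTripleRelation R) (g : ℕ → V) {t : ℕ}
    (ht : 0 < t) :
    #{r : V | #{c ∈ range (2 * t) | ¬ IsBlockedAt R ℓ g r c} < t} ≤ 8 * ℓ ^ 2 := by
  set D : Finset V := {r : V | #{c ∈ range (2 * t) | ¬ IsBlockedAt R ℓ g r c} < t}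
  have hgap : ∀ c ∈ range (2 * t), #{r ∈ D | IsBlockedAt R ℓ g r c} ≤ 4 * ℓ ^ 2 := by
    intro c _
    set W := (Ico (c * ℓ) ((c + 2) * ℓ)).image g
    have hW : #W ≤ 2 * ℓ := by
      refine card_image_le.trans ?_
      rw [Nat.card_Ico, add_mul]
      omega
    calc #{r ∈ D | IsBlockedAt R ℓ g r c} ≤ #{x : V | ∃ p ∈ W ×ˢ W, R x p.1 p.2} := by
          refine card_le_card fun x hx => ?_
          obtain ⟨-, i, hi, j, hj, hr⟩ := mem_filter.1 hx
          exact mem_filter.2 ⟨mem_univ _, (g i, g j),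
            mem_product.2 ⟨mem_image_of_mem _ hi, mem_image_of_mem _ hj⟩, hr⟩
      _ ≤ #W * #W := (hR.card_third_points_le _).trans (card_product _ _).le
      _ ≤ 2 * ℓ * (2 * ℓ) := Nat.mul_le_mul hW hW
      _ = 4 * ℓ ^ 2 := by ring
  have hpoint : ∀ r ∈ D, t ≤ #{c ∈ range (2 * t) | IsBlockedAt R ℓ g r c} := by
    intro r hr
    have h1 := (mem_filter.1 hr).2
    have h2 : #{c ∈ range (2 * t) | IsBlockedAt R ℓ g r c} +
        #{c ∈ range (2 * t) | ¬ IsBlockedAt R ℓ g r c} = 2 * t := by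
      rw [card_filter_add_card_filter_not, card_range]
    omega
  have hcount := card_mul_le_card_mul (IsBlockedAt R ℓ g) hpoint hgap
  rw [card_range] at hcount
  refine Nat.le_of_mul_le_mul_right ?_ ht
  calc #D * t ≤ 2 * t * (4 * ℓ ^ 2) := hcount
    _ = 8 * ℓ ^ 2 * t := by ring

/-- There is a long good prefix such that the points outside it can be inserted in distinct free
gaps. -/
lemma IsTripleRelation.exists_prefix_gaps (hR : IsTripleRelation R)
    (hcard : (2 * (ℓ ^ 2 + ℓ + 1) + 1) * ℓ + 8 * ℓ ^ 2 * (ℓ + 1) + (ℓ ^ 2 + ℓ + 1) ≤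
      Fintype.card V) :
    ∃ (N : ℕ) (g : ℕ → V) (gap : V → ℕ), IsGoodPrefix R ℓ N g ∧
      Set.InjOn gap {v | ¬ ∃ i < N, g i = v} ∧
      ∀ v, (¬ ∃ i < N, g i = v) → ¬ IsBlockedAt R ℓ g v (gap v) ∧ (gap v + 2) * ℓ ≤ N := by
  classical
  set t := ℓ ^ 2 + ℓ + 1 with ht
  set M := (2 * t + 1) * ℓ with hM
  have hV : Nonempty V := Fintype.card_pos_iff.1 (by omega)
  have hgood₀ : IsGoodPrefix R ℓ 0 fun _ => hV.some :=
    ⟨fun i hi => absurd hi (Nat.not_lt_zero i), fun i j k _ _ hk => absurd hk (Nat.not_lt_zero k)⟩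
  obtain ⟨g₁, -, hgood₁⟩ := hgood₀.exists_extend hR M (by omega)
  rw [zero_add] at hgood₁
  set D : Finset V := {r : V | #{c ∈ range (2 * t) | ¬ IsBlockedAt R ℓ g₁ r c} < t} with hD
  have hDcard : #D * (ℓ + 1) ≤ 8 * ℓ ^ 2 * (ℓ + 1) :=
    Nat.mul_le_mul_right _ (hR.card_mostly_blocked_le g₁ (by omega))
  obtain ⟨N₂, g₂, hN₂, hN₂', hg₂, hgood₂, hD₂⟩ := hgood₁.exists_extend_subset hR D (by omega)
  obtain ⟨k, hk⟩ : ∃ k, N₂ + k + t = Fintype.card V :=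
    ⟨Fintype.card V - N₂ - t, by omega⟩
  obtain ⟨g, hg, hgood⟩ := hgood₂.exists_extend hR k (by omega)
  set N := N₂ + k
  set L : Finset V := univ \ (range N).image g
  have hL : ∀ v, v ∈ L ↔ ¬ ∃ i < N, g i = v := fun v => by simp [L]
  have hLcard : #L ≤ t := by
    rw [card_univ_sdiff, card_image_of_injOn (by simpa [Set.InjOn] using hgood.1), card_range]
    omega
  obtain ⟨gap, hinj, hgap⟩ := exists_free_gaps (R := R) (ℓ := ℓ) g₁ L hLcard fun r hr => by
    by_contra! hlt
    obtain ⟨i, hi, rfl⟩ := hD₂ r (mem_filter.2 ⟨mem_univ _, hlt⟩)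
    exact (hL _).1 hr ⟨i, by omega, hg i hi⟩
  refine ⟨N, g, gap, hgood, fun a ha b hb => hinj ((hL a).2 ha) ((hL b).2 hb), fun v hv => ?_⟩
  obtain ⟨hlt, hfree⟩ := hgap v ((hL v).2 hv)
  have hle : (gap v + 2) * ℓ ≤ M := Nat.mul_le_mul_right _ (by omega)
  refine ⟨fun ⟨i, hi, j, hj, hr⟩ => hfree ⟨i, hi, j, hj, ?_⟩, by omega⟩
  have hi' := (mem_Ico.1 hi).2
  have hj' := (mem_Ico.1 hj).2
  rwa [hg i (by omega), hg₂ i (by omega), hg j (by omega), hg₂ j (by omega)] at hr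

/-- There are labels for all points, including every even number below some bound, such that in
each triple some two labels differ by at least `2 * ℓ`. -/
lemma IsTripleRelation.exists_labels (hR : IsTripleRelation R) (hℓ : 0 < ℓ)
    (hcard : (2 * (ℓ ^ 2 + ℓ + 1) + 1) * ℓ + 8 * ℓ ^ 2 * (ℓ + 1) + (ℓ ^ 2 + ℓ + 1) ≤
      Fintype.card V) :
    ∃ (N : ℕ) (g : ℕ → V) (f : V → ℕ), Function.Injective f ∧ (∀ i < N, f (g i) = 2 * i) ∧
      (∀ v, f v < 2 * N) ∧
      ∀ x y z, x ≠ y → y ≠ z → x ≠ z → R x y z →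
        ∃ u ∈ ({x, y, z} : Finset V), ∃ w ∈ ({x, y, z} : Finset V), f u + 2 * ℓ ≤ f w := by
  classical
  obtain ⟨N, g, gap, hgood, hinj, hgap⟩ := hR.exists_prefix_gaps hcard
  have hpos : ∀ v, ∃ i, (∃ i < N, g i = v) → i < N ∧ g i = v := fun v => by
    by_cases h : ∃ i < N, g i = v
    · exact h.imp fun i hi _ => hi
    · exact ⟨0, fun h' => absurd h' h⟩
  choose pos hpos using hpos
  set f : V → ℕ := fun v =>
    if ∃ i < N, g i = v then 2 * pos v else 2 * (gap v * ℓ + ℓ) - 1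
  have hfg : ∀ i < N, f (g i) = 2 * i := fun i hi => by
    have h : ∃ j < N, g j = g i := ⟨i, hi, rfl⟩
    obtain ⟨h1, h2⟩ := hpos (g i) h
    simp only [f, h, if_true]
    rw [hgood.1 h1 hi h2]
  have hfgap : ∀ v, (¬ ∃ i < N, g i = v) → f v = 2 * (gap v * ℓ + ℓ) - 1 := fun v hv => by
    simp only [f, hv, if_false]
  have hgapN : ∀ v, (¬ ∃ i < N, g i = v) → gap v * ℓ + 2 * ℓ ≤ N := fun v hv => by
    rw [← add_mul]
    exact (hgap v hv).2
  have hgaps : ∀ v w, (¬ ∃ i < N, g i = v) → (¬ ∃ i < N, g i = w) → v ≠ w →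
      f v + 2 * ℓ ≤ f w ∨ f w + 2 * ℓ ≤ f v := by
    intro v w hv hw hvw
    rw [hfgap v hv, hfgap w hw]
    rcases lt_trichotomy (gap v) (gap w) with h | h | h
    · have := Nat.mul_le_mul_right ℓ (Nat.succ_le_of_lt h)
      rw [Nat.succ_mul] at this
      omega
    · exact absurd (hinj hv hw h) hvw
    · have := Nat.mul_le_mul_right ℓ (Nat.succ_le_of_lt h)
      rw [Nat.succ_mul] at this
      omega
  have hmixed : ∀ v x y, (¬ ∃ i < N, g i = v) → (∃ i < N, g i = x) → (∃ i < N, g i = y) →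
      R v x y → (f v + 2 * ℓ ≤ f x ∨ f x + 2 * ℓ ≤ f v) ∨
        (f v + 2 * ℓ ≤ f y ∨ f y + 2 * ℓ ≤ f v) := by
    rintro v _ _ hv ⟨i, hi, rfl⟩ ⟨j, hj, rfl⟩ hr
    have h := (hgap v hv).1
    contrapose! h
    rw [hfgap v hv, hfg i hi, hfg j hj] at h
    refine ⟨i, mem_Ico.2 ?_, j, mem_Ico.2 ?_, hr⟩ <;> rw [add_mul] <;> omega
  have hsorted : ∀ i j k, i < j → j < k → k < N → R (g k) (g i) (g j) →
      f (g i) + 2 * ℓ ≤ f (g k) := by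
    intro i j k hij hjk hk hr
    have := hgood.2 i j k hij hjk hk hr
    rw [hfg i (by omega), hfg k hk]
    omega
  refine ⟨N, g, f, fun v w hvw => ?_, hfg, fun v => ?_, fun x y z hxy hyz hxz hr => ?_⟩
  · by_cases hv : ∃ i < N, g i = v <;> by_cases hw : ∃ i < N, g i = w
    · obtain ⟨i, hi, rfl⟩ := hv
      obtain ⟨j, hj, rfl⟩ := hw
      rw [hfg i hi, hfg j hj] at hvw
      congr 1
      omega
    · obtain ⟨i, hi, rfl⟩ := hv
      rw [hfg i hi, hfgap w hw] at hvw
      omega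
    · obtain ⟨j, hj, rfl⟩ := hw
      rw [hfg j hj, hfgap v hv] at hvw
      omega
    · by_contra hne
      have := hgaps v w hv hw hne
      omega
  · by_cases hv : ∃ i < N, g i = v
    · obtain ⟨i, hi, rfl⟩ := hv
      rw [hfg i hi]
      omega
    · have := hgapN v hv
      rw [hfgap v hv]
      omega
  · suffices h : (f x + 2 * ℓ ≤ f y ∨ f y + 2 * ℓ ≤ f x) ∨
        (f x + 2 * ℓ ≤ f z ∨ f z + 2 * ℓ ≤ f x) ∨ (f y + 2 * ℓ ≤ f z ∨ f z + 2 * ℓ ≤ f y) by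
      simp only [mem_insert, mem_singleton, exists_eq_or_imp, exists_eq_left]
      tauto
    have hxzy := hR.swap_right hr
    have hyxz := hR.swap_left hr
    have hyzx := hR.swap_right hyxz
    have hzxy := hR.swap_left hxzy
    have hzyx := hR.swap_right hzxy
    by_cases hx : ∃ i < N, g i = x <;> by_cases hy : ∃ i < N, g i = y <;>
      by_cases hz : ∃ i < N, g i = z
    · obtain ⟨i, hi, rfl⟩ := hx
      obtain ⟨j, hj, rfl⟩ := hy
      obtain ⟨k, hk, rfl⟩ := hz
      have hij : i ≠ j := fun h => hxy (h ▸ rfl)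
      have hjk : j ≠ k := fun h => hyz (h ▸ rfl)
      have hik : i ≠ k := fun h => hxz (h ▸ rfl)
      rcases hij.lt_or_gt with hij | hij <;> rcases hjk.lt_or_gt with hjk | hjk <;>
        rcases hik.lt_or_gt with hik | hik
      · have := hsorted i j k hij hjk hk hzxy
        tauto
      · omega
      · have := hsorted i k j hik hjk hj hyxz
        tauto
      · have := hsorted k i j hik hij hj hyzx
        tauto
      · have := hsorted j i k hij hik hk hzyx
        tauto
      · have := hsorted j k i hjk hik hi hr
        tauto
      · omega
      · have := hsorted k j i hjk hij hi hxzy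
        tauto
    · have := hmixed z x y hz hx hy hzxy
      tauto
    · have := hmixed y x z hy hx hz hyxz
      tauto
    · have := hgaps y z hy hz hyz
      tauto
    · have := hmixed x y z hx hy hz hr
      tauto
    · have := hgaps x z hx hz hxz
      tauto
    · have := hgaps x y hx hy hxy
      tauto
    · have := hgaps x y hx hy hxy
      tauto

/-- If the labels include all even numbers below a bound, then in the order of the labels two
points whose labels differ by at least `2 * ℓ` are not in a common segment of length `ℓ`. -/
lemma exists_list_of_labels {N : ℕ} {g : ℕ → V} {f : V → ℕ}
    (hf : Function.Injective f) (hg : ∀ i < N, f (g i) = 2 * i) (hN : ∀ v, f v < 2 * N) :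
    ∃ xs : List V, xs.Nodup ∧ (∀ v : V, v ∈ xs) ∧
      ∀ i m : ℕ, m ≤ ℓ → ∀ u ∈ (xs.drop i).take m, ∀ w ∈ (xs.drop i).take m,
        f w < f u + 2 * ℓ := by
  set xs := (univ : Finset V).toList.insertionSort fun a b => f a ≤ f b
  have hperm : xs.Perm (univ : Finset V).toList := List.perm_insertionSort _ _
  have hsorted : xs.Pairwise fun a b => f a ≤ f b := by
    have : Std.Total fun a b : V => f a ≤ f b := ⟨fun a b => le_total _ _⟩
    have : IsTrans V fun a b : V => f a ≤ f b := ⟨fun a b c => le_trans⟩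
    exact List.pairwise_insertionSort _ _
  have hmem : ∀ v, v ∈ xs := fun v => hperm.mem_iff.2 (mem_toList.2 (mem_univ v))
  refine ⟨xs, hperm.nodup_iff.2 (nodup_toList _), hmem, fun i m hm u hu w hw => ?_⟩
  by_contra! hlt
  set W := (xs.drop i).take m with hW
  have hsplit : xs = xs.take i ++ (W ++ (xs.drop i).drop m) := by simp [hW]
  rw [hsplit, List.pairwise_append, List.pairwise_append] at hsorted
  obtain ⟨-, ⟨-, -, hright⟩, hleft⟩ := hsorted
  have hbetween : ∀ v, f u < f v → f v < f w → v ∈ W := by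
    intro v huv hvw
    have hv := hmem v
    rw [hsplit, List.mem_append, List.mem_append] at hv
    rcases hv with hv | hv | hv
    · exact absurd (hleft v hv u (List.mem_append_left _ hu)) huv.not_ge
    · exact hv
    · exact absurd (hright w hw v hv) hvw.not_ge
  set I := Ico (f u / 2 + 1) (f u / 2 + 1 + ℓ)
  have hI : ∀ j ∈ I, f u < f (g j) ∧ f (g j) ≤ f w ∧ f (g j) = 2 * j := by
    intro j hj
    have := mem_Ico.1 hj
    have := hN w
    rw [hg j (by omega)]
    omega
  have hsub : insert u (I.image g) ⊆ W.toFinset := by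
    refine insert_subset (List.mem_toFinset.2 hu) fun v hv => List.mem_toFinset.2 ?_
    obtain ⟨j, hj, rfl⟩ := mem_image.1 hv
    obtain ⟨h1, h2, -⟩ := hI j hj
    rcases h2.lt_or_eq with h2 | h2
    · exact hbetween _ h1 h2
    · rwa [hf h2]
  have hu : u ∉ I.image g := by
    intro h
    obtain ⟨j, hj, rfl⟩ := mem_image.1 h
    exact lt_irrefl _ (hI j hj).1
  have hcard : #(I.image g) = ℓ := by
    rw [card_image_of_injOn, Nat.card_Ico]
    · omega
    · intro a ha b hb hab
      have h1 := (hI a ha).2.2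
      have h2 := (hI b hb).2.2
      rw [hab] at h1
      omega
  have h1 := card_le_card hsub
  rw [card_insert_of_notMem hu, hcard] at h1
  have h2 := W.toFinset_card_le
  have h3 : W.length ≤ m := List.length_take_le _ _
  omega

end

lemma isTripleRelation_of_blocks {V : Type} [DecidableEq V] {B : Set (Finset V)}
    (hB : ∀ b ∈ B, ∀ b' ∈ B, b ≠ b' → (b ∩ b').card ≤ 1) :
    IsTripleRelation fun x y z => x ≠ y ∧ y ≠ z ∧ x ≠ z ∧ ({x, y, z} : Finset V) ∈ B where
  swap_left := by
    rintro a b c ⟨hab, hbc, hac, h⟩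
    refine ⟨hab.symm, hac, hbc, ?_⟩
    rwa [Finset.insert_comm]
  swap_right := by
    rintro a b c ⟨hab, hbc, hac, h⟩
    refine ⟨hac, hbc.symm, hab, ?_⟩
    rwa [Finset.pair_comm]
  unique := by
    rintro a b c d ⟨hac, hcd, had, h⟩ ⟨hbc, -, hbd, h'⟩
    by_contra hab
    have hne : ({a, c, d} : Finset V) ≠ {b, c, d} := by
      intro he
      have : a ∈ ({b, c, d} : Finset V) := he ▸ Finset.mem_insert_self _ _
      simp_all
    have hle := hB _ h _ h' hne
    have hsub : ({c, d} : Finset V) ⊆ {a, c, d} ∩ {b, c, d} := by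
      intro v
      simp only [Finset.mem_insert, Finset.mem_singleton, Finset.mem_inter]
      tauto
    have := Finset.card_le_card hsub
    rw [Finset.card_pair hcd] at this
    omega


/-- there is a constant `C > 0` such that every partial Steiner
triple system on `n ≥ ℓ⁴/2 + C·ℓ³` points has an `ℓ`-good sequencing. -/
theorem stmt_3 :
    ∃ C : ℝ, 0 < C ∧ ∀ (ℓ n : ℕ), 0 < ℓ →
      (n : ℝ) ≥ (ℓ : ℝ) ^ 4 / 2 + C * (ℓ : ℝ) ^ 3 →
      ∀ (V : Type) [Fintype V] [DecidableEq V], Fintype.card V = n →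
      ∀ B : Set (Finset V),
        (∀ b ∈ B, b.card = 3) →
        (∀ b ∈ B, ∀ b' ∈ B, b ≠ b' → (b ∩ b').card ≤ 1) →
        ∃ xs : List V, xs.Nodup ∧ (∀ v : V, v ∈ xs) ∧
          ∀ i m : ℕ, m ≤ ℓ → ∀ b ∈ B, ¬ (∀ v ∈ b, v ∈ (xs.drop i).take m) := by
  classical
  refine ⟨30, by norm_num, fun ℓ n hℓ hn V _ _ hV B hB3 hB => ?_⟩
  have hR := isTripleRelation_of_blocks hB
  have hn' : 30 * ℓ ^ 3 ≤ n := by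
    have h4 : (0 : ℝ) ≤ (ℓ : ℝ) ^ 4 / 2 := by positivity
    have : (30 * (ℓ : ℝ) ^ 3) ≤ n := by linarith
    exact_mod_cast this
  have h1 : ℓ ≤ ℓ ^ 3 := Nat.le_self_pow (by norm_num) ℓ
  have h2 : ℓ ^ 2 ≤ ℓ ^ 3 := Nat.pow_le_pow_right hℓ (by norm_num)
  obtain ⟨N, g, f, hf, hg, hN, hfar⟩ := hR.exists_labels (ℓ := ℓ) hℓ (by
    rw [hV]
    ring_nf
    omega)
  obtain ⟨xs, hnodup, hmem, hseg⟩ := exists_list_of_labels (ℓ := ℓ) hf hg hN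
  refine ⟨xs, hnodup, hmem, fun i m hm b hb hall => ?_⟩
  obtain ⟨x, y, z, hxy, hxz, hyz, rfl⟩ := Finset.card_eq_three.1 (hB3 b hb)
  obtain ⟨u, hu, w, hw, huw⟩ := hfar x y z hxy hyz hxz ⟨hxy, hyz, hxz, hb⟩
  exact (hseg i m hm u (hall u hu) w (hall w hw)).not_ge huw
end

section
/- There exists a real constant C > 0 such that for every positive integer ℓ and every integer n with n ≥ (3/4)·ℓ⁴ + C·ℓ³, every partial directed triple system on a point set of cardinality n has an ℓ-good sequencing. -/
/-- The three ordered pairs contained in a transitive triple `(x,y,z)`. -/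
def ttPairs {V : Type} (t : V × V × V) : Set (V × V) :=
  {(t.1, t.2.1), (t.1, t.2.2), (t.2.1, t.2.2)}

/-- `f` places distinct points at the positions in `D`, and no triple of `T` occurs in order at
positions of `D` that fit into a window of length `ℓ`. -/
def GoodOn {V : Type} (T : Set (V × V × V)) (ℓ : ℕ) (D : Finset ℕ) (f : ℕ → V) : Prop :=
  Set.InjOn f D ∧ ∀ i ∈ D, ∀ j ∈ D, ∀ k ∈ D, i < j → j < k → k < i + ℓ → (f i, f j, f k) ∉ T

/-- Placing `x` at position `p` completes a triple of `T` with the points at positions `i < j`,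
inside a window of length `ℓ`. -/
def Completes {V : Type} (T : Set (V × V × V)) (ℓ : ℕ) (f : ℕ → V) (p : ℕ) (x : V)
    (i j : ℕ) : Prop :=
  (i < j ∧ j < p ∧ p < i + ℓ ∧ (f i, f j, x) ∈ T) ∨
  (i < p ∧ p < j ∧ j < i + ℓ ∧ (f i, x, f j) ∈ T) ∨
  (p < i ∧ i < j ∧ j < p + ℓ ∧ (x, f i, f j) ∈ T)

open Classical in
/-- The points that cannot be placed at position `p`, given the points `f` places on `D`. -/
noncomputable def blocked {V : Type} [Fintype V] (T : Set (V × V × V)) (ℓ : ℕ) (D : Finset ℕ)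
    (f : ℕ → V) (p : ℕ) : Finset V :=
  {x | ∃ i ∈ D, ∃ j ∈ D, Completes T ℓ f p x i j}

lemma mem_blocked {V : Type} [Fintype V] {T : Set (V × V × V)} {ℓ : ℕ} {D : Finset ℕ}
    {f : ℕ → V} {p : ℕ} {x : V} :
    x ∈ blocked T ℓ D f p ↔ ∃ i ∈ D, ∃ j ∈ D, Completes T ℓ f p x i j := by
  simp [blocked]

lemma card_blocked_le {V : Type} [Fintype V] {T : Set (V × V × V)}
    (hT : ∀ t ∈ T, ∀ t' ∈ T, ∀ p : V × V, p ∈ ttPairs t → p ∈ ttPairs t' → t = t')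
    (ℓ : ℕ) (D : Finset ℕ) (f : ℕ → V) (p : ℕ) :
    (blocked T ℓ D f p).card ≤ 4 * ℓ ^ 2 := by
  have hwin : (Finset.Ico (p + 1 - ℓ) (p + ℓ)).card ≤ 2 * ℓ := by
    rw [Nat.card_Ico]; omega
  refine le_trans (Finset.card_le_card_of_forall_subsingleton
    (t := Finset.Ico (p + 1 - ℓ) (p + ℓ) ×ˢ Finset.Ico (p + 1 - ℓ) (p + ℓ))
    (fun x q => Completes T ℓ f p x q.1 q.2) ?_ ?_) ?_
  · intro x hx
    obtain ⟨i, -, j, -, h⟩ := mem_blocked.1 hx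
    refine ⟨(i, j), ?_, h⟩
    simp only [Finset.mem_product, Finset.mem_Ico]
    rcases h with h | h | h <;> omega
  · rintro ⟨i, j⟩ - x ⟨-, hx⟩ y ⟨-, hy⟩
    rcases hx with hx | hx | hx <;> rcases hy with hy | hy | hy <;> first | omega | skip
    · have := hT _ hx.2.2.2 _ hy.2.2.2 (f i, f j) (by simp [ttPairs]) (by simp [ttPairs])
      simpa using this
    · have := hT _ hx.2.2.2 _ hy.2.2.2 (f i, f j) (by simp [ttPairs]) (by simp [ttPairs])
      simpa using this
    · have := hT _ hx.2.2.2 _ hy.2.2.2 (f i, f j) (by simp [ttPairs]) (by simp [ttPairs])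
      simpa using this
  · rw [Finset.card_product]
    calc _ ≤ (2 * ℓ) * (2 * ℓ) := Nat.mul_le_mul hwin hwin
      _ = 4 * ℓ ^ 2 := by ring

/-- Positions in `H` that are at least `ℓ` apart can be filled simultaneously by unused points
that are not blocked. -/
lemma GoodOn.exists_extend {V : Type} [Fintype V] {T : Set (V × V × V)} {ℓ : ℕ}
    {D H : Finset ℕ} {f : ℕ → V} (hf : GoodOn T ℓ D f)
    (hdisj : ∀ p ∈ D, p ∉ H) (hsep : ∀ p ∈ H, ∀ q ∈ H, p < q → p + ℓ ≤ q)
    (g : H → V) (hg : Function.Injective g) (hgf : ∀ p, ∀ i ∈ D, f i ≠ g p)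
    (hgb : ∀ p : H, g p ∉ blocked T ℓ D f p) :
    ∃ f' : ℕ → V, GoodOn T ℓ (D ∪ H) f' ∧ (∀ p ∈ D, f' p = f p) ∧ ∀ p : H, f' p = g p := by
  have hb : ∀ p (hp : p ∈ H), ∀ i ∈ D, ∀ j ∈ D, ¬ Completes T ℓ f p (g ⟨p, hp⟩) i j :=
    fun p hp i hi j hj h => hgb ⟨p, hp⟩ (mem_blocked.2 ⟨i, hi, j, hj, h⟩)
  have hD : ∀ p ∈ D, (fun p => if h : p ∈ H then g ⟨p, h⟩ else f p) p = f p :=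
    fun p hp => dif_neg (hdisj p hp)
  have hH : ∀ p (hp : p ∈ H), (fun p => if h : p ∈ H then g ⟨p, h⟩ else f p) p = g ⟨p, hp⟩ :=
    fun p hp => dif_pos hp
  refine ⟨fun p => if h : p ∈ H then g ⟨p, h⟩ else f p, ?_, hD, fun p => hH p p.2⟩
  generalize (fun p => if h : p ∈ H then g ⟨p, h⟩ else f p) = f' at hD hH ⊢
  refine ⟨?_, ?_⟩
  · intro p hp q hq hpq
    rcases Finset.mem_union.1 (Finset.mem_coe.1 hp) with hp | hp <;>
      rcases Finset.mem_union.1 (Finset.mem_coe.1 hq) with hq | hq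
    · rw [hD p hp, hD q hq] at hpq
      exact hf.1 hp hq hpq
    · rw [hD p hp, hH q hq] at hpq
      exact absurd hpq (hgf _ _ hp)
    · rw [hH p hp, hD q hq] at hpq
      exact absurd hpq.symm (hgf _ _ hq)
    · rw [hH p hp, hH q hq] at hpq
      simpa using hg hpq
  · intro i hi j hj k hk hij hjk hki ht
    rcases Finset.mem_union.1 hi with hi | hi <;> rcases Finset.mem_union.1 hj with hj | hj <;>
      rcases Finset.mem_union.1 hk with hk | hk
    · rw [hD i hi, hD j hj, hD k hk] at ht
      exact hf.2 i hi j hj k hk hij hjk hki ht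
    · rw [hD i hi, hD j hj, hH k hk] at ht
      exact hb k hk i hi j hj (Or.inl ⟨hij, hjk, hki, ht⟩)
    · rw [hD i hi, hH j hj, hD k hk] at ht
      exact hb j hj i hi k hk (Or.inr (Or.inl ⟨hij, hjk, hki, ht⟩))
    · have := hsep j hj k hk hjk; omega
    · rw [hH i hi, hD j hj, hD k hk] at ht
      exact hb i hi j hj k hk (Or.inr (Or.inr ⟨hij, hjk, hki, ht⟩))
    · have := hsep i hi k hk (hij.trans hjk); omega
    · have := hsep i hi j hj hij; omega
    · have := hsep i hi j hj hij; omega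

/-- Greedy filling of the positions in `E`. -/
lemma GoodOn.exists_fill {V : Type} [Fintype V] {T : Set (V × V × V)}
    (hT : ∀ t ∈ T, ∀ t' ∈ T, ∀ p : V × V, p ∈ ttPairs t → p ∈ ttPairs t' → t = t')
    {ℓ : ℕ} {D : Finset ℕ} {f : ℕ → V} (hf : GoodOn T ℓ D f) (E : Finset ℕ)
    (hdisj : ∀ p ∈ D, p ∉ E) (hcard : D.card + E.card + 4 * ℓ ^ 2 ≤ Fintype.card V) :
    ∃ f' : ℕ → V, GoodOn T ℓ (D ∪ E) f' ∧ ∀ p ∈ D, f' p = f p := by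
  classical
  induction E using Finset.induction_on with
  | empty => exact ⟨f, by simpa using hf, fun _ _ => rfl⟩
  | insert p E hp ih =>
    rw [Finset.card_insert_of_notMem hp] at hcard
    obtain ⟨f₁, hf₁, hag⟩ := ih (fun q hq h => hdisj q hq (Finset.mem_insert_of_mem h))
      (by omega)
    obtain ⟨x, hx⟩ : ∃ x, x ∉ (D ∪ E).image f₁ ∪ blocked T ℓ (D ∪ E) f₁ p := by
      by_contra! h
      have h₁ := Finset.card_le_card (fun x _ => h x : Finset.univ ⊆ _)
      have h₂ := Finset.card_union_le ((D ∪ E).image f₁) (blocked T ℓ (D ∪ E) f₁ p)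
      have h₃ := card_blocked_le hT ℓ (D ∪ E) f₁ p
      have h₄ := Finset.card_image_le (s := D ∪ E) (f := f₁)
      have h₅ := Finset.card_union_le D E
      rw [Finset.card_univ] at h₁
      omega
    rw [Finset.mem_union, not_or] at hx
    have hpD : p ∉ D := fun h => hdisj p h (Finset.mem_insert_self _ _)
    obtain ⟨f₂, hf₂, hag₂, -⟩ := hf₁.exists_extend (H := {p})
      (by
        intro q hq h
        rw [Finset.mem_singleton] at h
        subst h
        exact (Finset.mem_union.1 hq).elim hpD hp)
      (by
        intro a ha b hb
        rw [Finset.mem_singleton] at ha hb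
        omega)
      (fun _ => x)
      (fun a b _ => Subsingleton.elim a b)
      (fun _ i hi h => hx.1 (Finset.mem_image.2 ⟨i, hi, h⟩))
      (by
        rintro ⟨q, hq⟩
        rw [Finset.mem_singleton] at hq
        subst hq
        exact hx.2)
    refine ⟨f₂, ?_, fun q hq => (hag₂ q (Finset.mem_union_left _ hq)).trans (hag q hq)⟩
    rwa [Finset.union_assoc, Finset.union_comm E, ← Finset.insert_eq] at hf₂

/-- A partial directed triple system on at least `20 ℓ ^ 3` points has a good placement: points
are placed greedily around a set of spaced holes, those blocked at many holes are placed next,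
and the last points are matched to the holes by Hall's theorem. -/
lemma exists_goodOn_range {V : Type} [Fintype V] {T : Set (V × V × V)}
    (hT : ∀ t ∈ T, ∀ t' ∈ T, ∀ p : V × V, p ∈ ttPairs t → p ∈ ttPairs t' → t = t')
    {ℓ : ℕ} (hℓ : 0 < ℓ) (hcard : 20 * ℓ ^ 3 ≤ Fintype.card V) :
    ∃ f : ℕ → V, GoodOn T ℓ (Finset.range (Fintype.card V)) f := by
  classical
  set n := Fintype.card V with hn
  obtain ⟨M, hM⟩ : ∃ M, M = 8 * ℓ ^ 2 := ⟨_, rfl⟩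
  have hMl : M * ℓ = 8 * ℓ ^ 3 := by rw [hM]; ring
  have hℓ3 : ℓ ^ 2 ≤ ℓ ^ 3 := Nat.pow_le_pow_right hℓ (by norm_num)
  have hℓ2 : 0 < ℓ ^ 2 := by positivity
  have hne : Nonempty V := Fintype.card_pos_iff.1 (by omega)
  obtain ⟨v₀⟩ := hne
  obtain ⟨H, hH⟩ : ∃ H, H = (Finset.range M).image (fun k => k * ℓ) := ⟨_, rfl⟩
  have hHcard : H.card = M := by
    rw [hH, Finset.card_image_of_injective _ (fun a b h => Nat.eq_of_mul_eq_mul_right hℓ h),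
      Finset.card_range]
  have hHlt : ∀ h ∈ H, h + ℓ ≤ M * ℓ := by
    intro h hh
    rw [hH, Finset.mem_image] at hh
    obtain ⟨k, hk, rfl⟩ := hh
    rw [Finset.mem_range] at hk
    calc k * ℓ + ℓ = (k + 1) * ℓ := by ring
      _ ≤ M * ℓ := Nat.mul_le_mul_right _ hk
  have hHsep : ∀ p ∈ H, ∀ q ∈ H, p < q → p + ℓ ≤ q := by
    intro p hp q hq hpq
    rw [hH, Finset.mem_image] at hp hq
    obtain ⟨a, -, rfl⟩ := hp
    obtain ⟨b, -, rfl⟩ := hq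
    have hab : a + 1 ≤ b := Nat.lt_of_mul_lt_mul_right hpq
    calc a * ℓ + ℓ = (a + 1) * ℓ := by ring
      _ ≤ b * ℓ := Nat.mul_le_mul_right _ hab
  obtain ⟨A, hA⟩ : ∃ A, A = Finset.range (M * ℓ) \ H := ⟨_, rfl⟩
  have hAmem : ∀ p, p ∈ A ↔ p < M * ℓ ∧ p ∉ H := by
    intro p; rw [hA, Finset.mem_sdiff, Finset.mem_range]
  have hAcard : A.card ≤ M * ℓ := by
    rw [hA]; exact (Finset.card_le_card Finset.sdiff_subset).trans (Finset.card_range _).le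
  have hempty : GoodOn T ℓ ∅ (fun _ => v₀) := by simp [GoodOn]
  obtain ⟨f₁, hf₁, -⟩ := hempty.exists_fill hT A (by simp) (by rw [Finset.card_empty]; omega)
  rw [Finset.empty_union] at hf₁
  obtain ⟨B, hB⟩ : ∃ B : Finset V, B = Finset.univ.filter fun x => (∀ i ∈ A, f₁ i ≠ x) ∧
      4 * ℓ ^ 2 ≤ (H.filter fun h => x ∈ blocked T ℓ A f₁ h).card := ⟨_, rfl⟩
  have hBmem : ∀ x, x ∈ B ↔ (∀ i ∈ A, f₁ i ≠ x) ∧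
      4 * ℓ ^ 2 ≤ (H.filter fun h => x ∈ blocked T ℓ A f₁ h).card := by
    intro x; simp [hB]
  have hBcard : B.card ≤ M := by
    have := Finset.card_mul_le_card_mul (s := B) (t := H) (m := 4 * ℓ ^ 2) (n := 4 * ℓ ^ 2)
      (fun x h => x ∈ blocked T ℓ A f₁ h) (fun x hx => ((hBmem x).1 hx).2)
      (fun h _ => (Finset.card_le_card (fun x hx => (Finset.mem_filter.1 hx).2)).trans
        (card_blocked_le hT ℓ A f₁ h))
    rw [hHcard] at this
    exact Nat.le_of_mul_le_mul_right this (by omega)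
  obtain ⟨Q, hQ⟩ : ∃ Q, Q = (Finset.range B.card).image (fun k => M * ℓ + (k + 1) * ℓ) :=
    ⟨_, rfl⟩
  have hQcard : Q.card = B.card := by
    rw [hQ, Finset.card_image_of_injective _ (fun a b h => by
      have := Nat.eq_of_mul_eq_mul_right hℓ (Nat.add_left_cancel h)
      omega), Finset.card_range]
  have hQge : ∀ q ∈ Q, M * ℓ + ℓ ≤ q := by
    intro q hq
    rw [hQ, Finset.mem_image] at hq
    obtain ⟨k, -, rfl⟩ := hq
    nlinarith [Nat.zero_le (k * ℓ)]
  have hQlt : ∀ q ∈ Q, q < n := by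
    intro q hq
    rw [hQ, Finset.mem_image] at hq
    obtain ⟨k, hk, rfl⟩ := hq
    rw [Finset.mem_range] at hk
    have : (k + 1) * ℓ ≤ M * ℓ := Nat.mul_le_mul_right _ (by omega)
    omega
  have hQsep : ∀ p ∈ Q, ∀ q ∈ Q, p < q → p + ℓ ≤ q := by
    intro p hp q hq hpq
    rw [hQ, Finset.mem_image] at hp hq
    obtain ⟨a, -, rfl⟩ := hp
    obtain ⟨b, -, rfl⟩ := hq
    have hab : a + 1 < b + 1 := Nat.lt_of_mul_lt_mul_right (Nat.lt_of_add_lt_add_left hpq)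
    calc M * ℓ + (a + 1) * ℓ + ℓ = M * ℓ + (a + 1 + 1) * ℓ := by ring
      _ ≤ M * ℓ + (b + 1) * ℓ := Nat.add_le_add_left (Nat.mul_le_mul_right _ hab) _
  let e : Q ≃ B := Finset.equivOfCardEq hQcard
  obtain ⟨f₂, hf₂, hag₂, hval₂⟩ := hf₁.exists_extend (H := Q)
    (fun p hp hq => by have := hQge p hq; have := (hAmem p).1 hp; omega) hQsep
    (fun q => (e q : V)) (fun a b h => e.injective (Subtype.ext h))
    (fun q i hi => ((hBmem _).1 (e q).2).1 i hi)
    (by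
      intro q h
      obtain ⟨i, hi, j, hj, h⟩ := mem_blocked.1 h
      have := hQge q q.2
      have := (hAmem i).1 hi
      have := (hAmem j).1 hj
      rcases h with h | h | h <;> omega)
  obtain ⟨E, hE⟩ : ∃ E, E = Finset.range n \ (H ∪ (A ∪ Q)) := ⟨_, rfl⟩
  have hD : A ∪ Q ∪ E = Finset.range n \ H := by
    ext p
    simp only [hE, Finset.mem_union, Finset.mem_sdiff, Finset.mem_range]
    have h₁ := hAmem p
    have h₂ := hQge p
    have h₃ := hQlt p
    have h₄ := hHlt p
    constructor
    · rintro ((h | h) | h)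
      · exact ⟨(h₁.1 h).1.trans_le (by omega), (h₁.1 h).2⟩
      · exact ⟨h₃ h, fun h' => by have := h₂ h; have := h₄ h'; omega⟩
      · tauto
    · tauto
  have hHn : H ⊆ Finset.range n := fun h hh => by
    have := hHlt h hh
    rw [Finset.mem_range]; omega
  have hdisjE : ∀ p ∈ A ∪ Q, p ∉ E := by
    intro p hp h
    rw [hE, Finset.mem_sdiff] at h
    exact h.2 (Finset.mem_union_right _ hp)
  have hDcard : (A ∪ Q ∪ E).card + M = n := by
    have := Finset.card_le_card hHn
    rw [hD, Finset.card_sdiff_of_subset hHn, hHcard]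
    rw [hHcard] at this
    simp only [Finset.card_range] at this ⊢
    omega
  obtain ⟨f₃, hf₃, hag₃⟩ := hf₂.exists_fill hT E hdisjE (by
    rw [← Finset.card_union_of_disjoint (Finset.disjoint_left.2 hdisjE)]
    omega)
  obtain ⟨D, hDdef⟩ : ∃ D, D = A ∪ Q ∪ E := ⟨_, rfl⟩
  rw [← hDdef] at hD hDcard hf₃
  have hDA : ∀ p ∈ A, f₃ p = f₁ p := fun p hp =>
    (hag₃ p (Finset.mem_union_left _ hp)).trans (hag₂ p hp)
  have hAD : A ⊆ D := by
    rw [hDdef, Finset.union_assoc]; exact Finset.subset_union_left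
  have hblock : ∀ h ∈ H, blocked T ℓ D f₃ h ⊆ blocked T ℓ A f₁ h := by
    intro h hh x hx
    obtain ⟨i, hi, j, hj, hc⟩ := mem_blocked.1 hx
    have := hHlt h hh
    rw [hD, Finset.mem_sdiff] at hi hj
    have hi' : i ∈ A := (hAmem i).2 ⟨by rcases hc with hc | hc | hc <;> omega, hi.2⟩
    have hj' : j ∈ A := (hAmem j).2 ⟨by rcases hc with hc | hc | hc <;> omega, hj.2⟩
    refine mem_blocked.2 ⟨i, hi', j, hj', ?_⟩
    rwa [Completes, hDA i hi', hDA j hj'] at hc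
  obtain ⟨U, hU⟩ : ∃ U : Finset V, U = Finset.univ \ D.image f₃ := ⟨_, rfl⟩
  have hUcard : U.card = M := by
    rw [hU, Finset.card_sdiff_of_subset (Finset.subset_univ _), Finset.card_univ,
      Finset.card_image_of_injOn hf₃.1]
    omega
  have hUmem : ∀ x ∈ U, ∀ i ∈ D, f₃ i ≠ x := by
    intro x hx i hi h
    rw [hU, Finset.mem_sdiff] at hx
    exact hx.2 (Finset.mem_image.2 ⟨i, hi, h⟩)
  have hUfew : ∀ x ∈ U, (H.filter fun h => x ∈ blocked T ℓ A f₁ h).card < 4 * ℓ ^ 2 := by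
    intro x hx
    by_contra! hlt
    have hxB : x ∈ B := (hBmem x).2
      ⟨fun i hi => hDA i hi ▸ hUmem x hx i (hAD hi), hlt⟩
    have hq := (e.symm ⟨x, hxB⟩).2
    have hqAQ : (e.symm ⟨x, hxB⟩ : ℕ) ∈ A ∪ Q := Finset.mem_union_right _ hq
    refine hUmem x hx _ (hDdef ▸ Finset.mem_union_left _ hqAQ) ?_
    rw [hag₃ _ hqAQ, hval₂, Equiv.apply_symm_apply]
  obtain ⟨g, hg, hgmem⟩ := (Finset.all_card_le_biUnion_card_iff_exists_injective
    (fun h : H => U \ blocked T ℓ A f₁ h)).1 (by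
      intro s
      by_cases hs : U ⊆ s.biUnion fun h : H => U \ blocked T ℓ A f₁ h
      · have h₁ := Finset.card_le_card hs
        have h₂ := Finset.card_le_univ s
        rw [Fintype.card_coe] at h₂
        omega
      · obtain ⟨x, hxU, hx⟩ := Finset.not_subset.1 hs
        rcases s.eq_empty_or_nonempty with rfl | ⟨h, hh⟩
        · simp
        have h₁ : s.card ≤ (H.filter fun h => x ∈ blocked T ℓ A f₁ h).card := by
          rw [← Finset.card_map (Function.Embedding.subtype _)]
          refine Finset.card_le_card fun p hp => ?_
          obtain ⟨a, ha, rfl⟩ := Finset.mem_map.1 hp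
          refine Finset.mem_filter.2 ⟨a.2, ?_⟩
          by_contra hxa
          exact hx (Finset.mem_biUnion.2 ⟨a, ha, Finset.mem_sdiff.2 ⟨hxU, hxa⟩⟩)
        have h₂ := hUfew x hxU
        have h₃ := Finset.card_le_card
          (Finset.subset_biUnion_of_mem (fun h : H => U \ blocked T ℓ A f₁ h) hh)
        have h₄ := Finset.le_card_sdiff (blocked T ℓ A f₁ h) U
        have h₅ := card_blocked_le hT ℓ A f₁ h
        omega)
  simp only [Finset.mem_sdiff] at hgmem
  obtain ⟨f, hf, -⟩ := hf₃.exists_extend (H := H)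
    (fun p hp => by rw [hD, Finset.mem_sdiff] at hp; exact hp.2) hHsep g hg
    (fun p i hi => hUmem _ (hgmem p).1 i hi)
    (fun p hp => (hgmem p).2 (hblock p p.2 hp))
  rw [hD, Finset.sdiff_union_of_subset hHn] at hf
  exact ⟨f, hf⟩

lemma GoodOn.not_sublist {V : Type} {T : Set (V × V × V)} {ℓ n : ℕ} {f : ℕ → V}
    (hf : GoodOn T ℓ (Finset.range n) f) {i m : ℕ} (hm : m ≤ ℓ) {t : V × V × V} (ht : t ∈ T) :
    ¬ List.Sublist [t.1, t.2.1, t.2.2] ((((List.range n).map f).drop i).take m) := by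
  intro h
  rw [← List.map_drop, ← List.map_take, List.sublist_map_iff] at h
  obtain ⟨l, hl, hmap⟩ := h
  obtain ⟨p, q, r, rfl⟩ : ∃ p q r, l = [p, q, r] :=
    List.length_eq_three.1 (by simpa using (congrArg List.length hmap).symm)
  have hlt := ((List.pairwise_lt_range (n := n)).drop (i := i)).take (i := m) |>.sublist hl
  have hmem : ∀ a ∈ [p, q, r], i ≤ a ∧ a < i + m ∧ a < n := by
    intro a ha
    obtain ⟨k, hk, rfl⟩ := List.getElem_of_mem (hl.subset ha)
    simp only [List.length_take, List.length_drop, List.length_range] at hk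
    simp only [List.getElem_take, List.getElem_drop, List.getElem_range]
    omega
  simp only [List.pairwise_cons, List.mem_cons, List.not_mem_nil, or_false, forall_eq_or_imp,
    forall_eq] at hlt hmem
  simp only [List.map_cons, List.map_nil, List.cons.injEq, and_true] at hmap
  refine hf.2 p (by simp; omega) q (by simp; omega) r (by simp; omega) (by omega) (by omega)
    (by omega) ?_
  rw [← hmap.1, ← hmap.2.1, ← hmap.2.2]
  exact ht

/-- there is a constant `C > 0` such that every partial directed
triple system on `n ≥ (3/4)·ℓ⁴ + C·ℓ³` points has an `ℓ`-good sequencing. -/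
theorem stmt_4 :
    ∃ C : ℝ, 0 < C ∧ ∀ (ℓ n : ℕ), 0 < ℓ →
      (n : ℝ) ≥ (3 / 4 : ℝ) * (ℓ : ℝ) ^ 4 + C * (ℓ : ℝ) ^ 3 →
      ∀ (V : Type) [Fintype V] [DecidableEq V], Fintype.card V = n →
      ∀ T : Set (V × V × V),
        (∀ t ∈ T, t.1 ≠ t.2.1 ∧ t.1 ≠ t.2.2 ∧ t.2.1 ≠ t.2.2) →
        (∀ t ∈ T, ∀ t' ∈ T, ∀ p : V × V, p ∈ ttPairs t → p ∈ ttPairs t' → t = t') →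
        ∃ xs : List V, xs.Nodup ∧ (∀ v : V, v ∈ xs) ∧
          ∀ i m : ℕ, m ≤ ℓ → ∀ t ∈ T,
            ¬ List.Sublist [t.1, t.2.1, t.2.2] ((xs.drop i).take m) := by
  refine ⟨20, by norm_num, ?_⟩
  intro ℓ n hℓ hn V _ _ hV T _ hT
  subst hV
  have hcard : 20 * ℓ ^ 3 ≤ Fintype.card V := by
    have h : (0 : ℝ) ≤ 3 / 4 * (ℓ : ℝ) ^ 4 := by positivity
    have h' : (20 : ℝ) * (ℓ : ℝ) ^ 3 ≤ Fintype.card V := by linarith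
    exact_mod_cast h'
  obtain ⟨f, hf⟩ := exists_goodOn_range hT hℓ hcard
  refine ⟨(List.range (Fintype.card V)).map f, ?_, ?_, fun i m hm t ht => hf.not_sublist hm ht⟩
  · refine List.Nodup.map_on (fun x hx y hy h => hf.1 ?_ ?_ h) List.nodup_range
    · simpa using hx
    · simpa using hy
  · intro v
    have himg : (Finset.range (Fintype.card V)).image f = Finset.univ :=
      Finset.eq_univ_of_card _ (by rw [Finset.card_image_of_injOn hf.1, Finset.card_range])
    have hv := Finset.mem_univ v
    rw [← himg, Finset.mem_image] at hv
    simpa using hv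
end

section
/- Let t, k and λ be fixed integers with 2 ≤ t < k and λ ≥ 1. There exists a real constant C > 0 such that for every integer ℓ ≥ k and every integer n with n ≥ C·ℓ^(2t), every design S_λ(t,k,n) has an ℓ-good sequencing. -/
open Finset

/-- The points outside `W` that complete a block of `B` together with points of `W`. -/
def completingPoints {V : Type} [Fintype V] [DecidableEq V] (B : Finset (Finset V))
    (W : Finset V) : Finset V :=
  univ.filter fun v => v ∉ W ∧ ∃ b ∈ B, v ∈ b ∧ b ⊆ insert v W

/-- The points that `f` places on positions of `D` at distance less than `ℓ` from `p`. -/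
def nearbyPoints {V : Type} [DecidableEq V] (ℓ : ℕ) (D : Finset ℕ) (f : ℕ → V) (p : ℕ) :
    Finset V :=
  (D.filter fun q => q < p + ℓ ∧ p < q + ℓ).image f

/-- `f` places distinct points on the positions in `D`, and no window of `ℓ` consecutive
positions contains a block. -/
def IsGoodPlacement {V : Type} [DecidableEq V] (B : Finset (Finset V)) (ℓ : ℕ)
    (D : Finset ℕ) (f : ℕ → V) : Prop :=
  Set.InjOn f D ∧ ∀ a, ∀ b ∈ B, ¬ b ⊆ (D.filter fun q => a ≤ q ∧ q < a + ℓ).image f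

section

variable {V : Type} [DecidableEq V] {B : Finset (Finset V)} {ℓ : ℕ}

theorem card_nearbyPoints_le (D : Finset ℕ) (f : ℕ → V) (p : ℕ) :
    (nearbyPoints ℓ D f p).card ≤ 2 * ℓ := by
  refine card_image_le.trans ?_
  have h : (D.filter fun q => q < p + ℓ ∧ p < q + ℓ) ⊆ Ico (p + 1 - ℓ) (p + ℓ) := by
    intro q hq
    simp only [mem_filter, mem_Ico] at hq ⊢
    omega
  refine (card_le_card h).trans ?_
  rw [Nat.card_Ico]
  omega

theorem nearbyPoints_congr {D D' : Finset ℕ} {f g : ℕ → V} {p : ℕ} (hD : D ⊆ D')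
    (hfg : Set.EqOn g f D) (h : ∀ q ∈ D', q < p + ℓ → p < q + ℓ → q ∈ D) :
    nearbyPoints ℓ D' g p = nearbyPoints ℓ D f p := by
  have hfil : (D'.filter fun q => q < p + ℓ ∧ p < q + ℓ) =
      D.filter fun q => q < p + ℓ ∧ p < q + ℓ := by
    ext q
    simp only [mem_filter]
    exact ⟨fun ⟨h₁, h₂⟩ => ⟨h q h₁ h₂.1 h₂.2, h₂⟩, fun ⟨h₁, h₂⟩ => ⟨hD h₁, h₂⟩⟩
  unfold nearbyPoints
  rw [hfil]
  exact image_congr fun q hq => hfg (mem_filter.1 hq).1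

/-- If every slot is bad for at most `M` points and every point of `R` is bad for at most half
of the `2 * M` slots, then the points of `R` can be assigned to distinct slots. -/
theorem exists_injOn_slots {M : ℕ} {Q : Finset ℕ} {R : Finset V} (F : ℕ → Finset V)
    (hQ : Q.card = 2 * M) (hR : R.card = 2 * M) (hF : ∀ p, (F p).card ≤ M)
    (hE : ∀ v ∈ R, (Q.filter fun p => v ∈ F p).card ≤ M) [Nonempty V] :
    ∃ h : ℕ → V, Set.InjOn h Q ∧ ∀ p ∈ Q, h p ∈ R ∧ h p ∉ F p := by
  have hall : ∀ s : Finset Q, s.card ≤ (s.biUnion fun p => R \ F p).card := by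
    intro s
    by_cases hs : s.card ≤ M
    · rcases s.eq_empty_or_nonempty with rfl | ⟨p, hp⟩
      · simp
      · have h₁ : R \ F p ⊆ s.biUnion fun p => R \ F p :=
          subset_biUnion_of_mem (fun p : Q => R \ F p) hp
        have h₂ := card_le_card h₁
        have h₃ := le_card_sdiff (F p) R
        have h₄ := hF p
        omega
    · have hsub : R ⊆ s.biUnion fun p => R \ F p := by
        intro v hv
        by_contra hcon
        have hsv : s.map (Function.Embedding.subtype _) ⊆ Q.filter fun p => v ∈ F p := by
          intro p hp
          obtain ⟨q, hq, rfl⟩ := mem_map.1 hp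
          refine mem_filter.2 ⟨q.2, ?_⟩
          by_contra hvq
          exact hcon (mem_biUnion.2 ⟨q, hq, mem_sdiff.2 ⟨hv, hvq⟩⟩)
        have h₁ := card_le_card hsv
        rw [card_map] at h₁
        have h₂ := hE v hv
        omega
      have h₁ := card_le_card hsub
      have h₂ : s.card ≤ Q.card := by simpa using card_le_univ s
      omega
  obtain ⟨h, hinj, hmem⟩ := (all_card_le_biUnion_card_iff_exists_injective _).1 hall
  classical
  refine ⟨fun p => if hp : p ∈ Q then h ⟨p, hp⟩ else Classical.arbitrary V, ?_, fun p hp => ?_⟩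
  · intro x hx y hy hxy
    rw [mem_coe] at hx hy
    simp only [dif_pos hx, dif_pos hy] at hxy
    exact congrArg Subtype.val (hinj hxy)
  · simp only [dif_pos hp]
    exact mem_sdiff.1 (hmem ⟨p, hp⟩)

variable [Fintype V]

theorem card_completingPoints_le {t k lam : ℕ} (htk : t < k) (hcard : ∀ b ∈ B, b.card = k)
    (hB : ∀ T : Finset V, T.card = t → (B.filter (fun b => T ⊆ b)).card = lam)
    (W : Finset V) : (completingPoints B W).card ≤ W.card ^ t * lam := by
  classical
  have hsub : completingPoints B W ⊆ (W.powersetCard t).biUnion fun T =>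
      (B.filter (fun b => T ⊆ b)).biUnion fun b => if (b \ W).card ≤ 1 then b \ W else ∅ := by
    intro v hv
    simp only [completingPoints, mem_filter, mem_univ, true_and] at hv
    obtain ⟨hvW, b, hb, hvb, hbW⟩ := hv
    have hle : t ≤ (b.erase v).card := by
      rw [card_erase_of_mem hvb, hcard b hb]
      omega
    obtain ⟨T, hT, hTt⟩ := exists_subset_card_eq hle
    have hdiff : b \ W ⊆ {v} := by
      intro x hx
      rw [mem_sdiff] at hx
      rcases mem_insert.1 (hbW hx.1) with h | h
      · simpa using h
      · exact absurd h hx.2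
    have hcd : (b \ W).card ≤ 1 := by simpa using card_le_card hdiff
    simp only [mem_biUnion, mem_powersetCard, mem_filter]
    refine ⟨T, ⟨fun x hx => ?_, hTt⟩, b, ⟨hb, hT.trans (erase_subset _ _)⟩, ?_⟩
    · have hx' := mem_erase.1 (hT hx)
      exact (mem_insert.1 (hbW hx'.2)).resolve_left hx'.1
    · rw [if_pos hcd]
      exact mem_sdiff.2 ⟨hvb, hvW⟩
  refine (card_le_card hsub).trans ?_
  refine (card_biUnion_le_card_mul _ _ lam fun T hT => ?_).trans ?_
  · refine (card_biUnion_le_card_mul _ _ 1 fun b _ => ?_).trans ?_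
    · split_ifs with h
      · exact h
      · simp
    · rw [hB T (mem_powersetCard.1 hT).2, mul_one]
  · rw [card_powersetCard]
    exact Nat.mul_le_mul_right _ (Nat.choose_le_pow _ _)

/-- Points can be added simultaneously on positions that are pairwise at distance at least `ℓ`. -/
theorem IsGoodPlacement.union {D P : Finset ℕ} {f h : ℕ → V} (hf : IsGoodPlacement B ℓ D f)
    (hP : ∀ p ∈ P, ∀ q ∈ P, p < q → p + ℓ ≤ q)
    (hinj : Set.InjOn h P) (hnew : ∀ p ∈ P, h p ∉ D.image f)
    (hbad : ∀ p ∈ P, h p ∉ completingPoints B (nearbyPoints ℓ D f p)) :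
    IsGoodPlacement B ℓ (D ∪ P) (fun x => if x ∈ P then h x else f x) := by
  have hnew' : ∀ p ∈ P, ∀ q ∈ D, f q ≠ h p := fun p hp q hq e =>
    hnew p hp (mem_image.2 ⟨q, hq, e⟩)
  refine ⟨?_, fun a b hb hsub => ?_⟩
  · intro x hx y hy hxy
    simp only [coe_union, Set.mem_union, mem_coe] at hx hy
    dsimp only at hxy
    split_ifs at hxy with h₁ h₂ h₂
    · exact hinj h₁ h₂ hxy
    · exact absurd hxy.symm (hnew' x h₁ y (hy.resolve_right h₂))
    · exact absurd hxy (hnew' y h₂ x (hx.resolve_right h₁))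
    · exact hf.1 (hx.resolve_right h₁) (hy.resolve_right h₂) hxy
  · have key : ∃ p ∈ P, a ≤ p ∧ p < a + ℓ ∧ h p ∈ b := by
      by_contra! hcon
      refine hf.2 a b hb fun x hx => ?_
      obtain ⟨q, hq, hqx⟩ := mem_image.1 (hsub hx)
      simp only [mem_filter, mem_union] at hq
      by_cases hqP : q ∈ P
      · rw [if_pos hqP] at hqx
        exact absurd (hqx ▸ hx) (hcon q hqP hq.2.1 hq.2.2)
      · rw [if_neg hqP] at hqx
        exact mem_image.2 ⟨q, mem_filter.2 ⟨hq.1.resolve_right hqP, hq.2⟩, hqx⟩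
    obtain ⟨p, hp, hap, hpa, hpb⟩ := key
    refine hbad p hp ?_
    simp only [completingPoints, mem_filter, mem_univ, true_and]
    refine ⟨fun hmem => hnew p hp ?_, b, hb, hpb, fun x hx => ?_⟩
    · exact image_subset_image (filter_subset _ _) hmem
    · obtain ⟨q, hq, hqx⟩ := mem_image.1 (hsub hx)
      simp only [mem_filter, mem_union] at hq
      by_cases hqP : q ∈ P
      · rw [if_pos hqP] at hqx
        have hpq : q = p := by
          rcases lt_trichotomy p q with hlt | heq | hlt
          · have := hP p hp q hqP hlt
            omega
          · exact heq.symm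
          · have := hP q hqP p hp hlt
            omega
        rw [← hqx, hpq]
        exact mem_insert_self _ _
      · rw [if_neg hqP] at hqx
        refine mem_insert_of_mem (mem_image.2 ⟨q, mem_filter.2
          ⟨hq.1.resolve_right hqP, ?_, ?_⟩, hqx⟩) <;> omega

/-- Greedy extension of a good placement to a larger set of positions. -/
theorem IsGoodPlacement.exists_extension {M : ℕ}
    (hM : ∀ D f p, (completingPoints B (nearbyPoints ℓ D f p)).card ≤ M)
    {D : Finset ℕ} {f : ℕ → V} (hf : IsGoodPlacement B ℓ D f) (P : Finset ℕ) :
    Disjoint D P → D.card + P.card + M ≤ Fintype.card V →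
      ∃ g, IsGoodPlacement B ℓ (D ∪ P) g ∧ Set.EqOn g f D := by
  induction P using Finset.induction_on with
  | empty => exact fun _ _ => ⟨f, by simpa using hf, fun _ _ => rfl⟩
  | insert p P hp ih =>
    intro hdisj hcard
    rw [card_insert_of_notMem hp] at hcard
    rw [disjoint_insert_right] at hdisj
    obtain ⟨g, hg, hgf⟩ := ih hdisj.2 (by omega)
    have hlt : ((D ∪ P).image g ∪ completingPoints B (nearbyPoints ℓ (D ∪ P) g p)).card <
        Fintype.card V := by
      have h₁ := card_union_le ((D ∪ P).image g)
        (completingPoints B (nearbyPoints ℓ (D ∪ P) g p))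
      have h₂ : ((D ∪ P).image g).card ≤ (D ∪ P).card := card_image_le
      have h₃ := card_union_le D P
      have h₄ := hM (D ∪ P) g p
      omega
    obtain ⟨v, hv⟩ : ∃ v, v ∉ (D ∪ P).image g ∪
        completingPoints B (nearbyPoints ℓ (D ∪ P) g p) := by
      by_contra! hcon
      rw [eq_univ_iff_forall.2 hcon, card_univ] at hlt
      exact lt_irrefl _ hlt
    rw [mem_union, not_or] at hv
    have hres := hg.union (P := {p}) (h := fun _ => v) (by simp) (by simp)
      (by simpa using hv.1) (by simpa using hv.2)
    refine ⟨fun x => if x ∈ ({p} : Finset ℕ) then v else g x, ?_, ?_⟩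
    · rwa [insert_eq, union_comm {p}, ← union_assoc]
    · intro x hx
      have hxp : x ≠ p := fun e => hdisj.1 (e ▸ hx)
      simp only [mem_singleton, if_neg hxp]
      exact hgf hx

/-- A good placement on `range n` is a good sequencing. -/
theorem IsGoodPlacement.exists_sequencing {n : ℕ} {f : ℕ → V} (hn : Fintype.card V = n)
    (hf : IsGoodPlacement B ℓ (range n) f) :
    ∃ xs : List V, xs.Nodup ∧ (∀ v : V, v ∈ xs) ∧
      ∀ i m : ℕ, m ≤ ℓ → ∀ b ∈ B, ¬ (∀ v ∈ b, v ∈ (xs.drop i).take m) := by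
  refine ⟨(List.range n).map f, ?_, fun v => ?_, fun i m hm b hb hsub => ?_⟩
  · refine List.Nodup.map_on (fun x hx y hy hxy => hf.1 ?_ ?_ hxy) List.nodup_range
    · simpa using hx
    · simpa using hy
  · have h : (range n).image f = univ := by
      rw [← card_eq_iff_eq_univ, card_image_of_injOn hf.1, card_range, hn]
    have hv : v ∈ (range n).image f := h ▸ mem_univ v
    simpa using hv
  · refine hf.2 i b hb fun v hv => ?_
    have hv' := hsub v hv
    rw [← List.map_drop, ← List.map_take, List.mem_map] at hv'
    obtain ⟨q, hq, rfl⟩ := hv'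
    obtain ⟨j, hj, rfl⟩ := List.mem_iff_getElem.1 hq
    simp only [List.length_take, List.length_drop, List.length_range] at hj
    refine mem_image_of_mem f ?_
    simp only [List.getElem_take, List.getElem_drop, List.getElem_range, mem_filter, mem_range]
    omega

/-- A good placement on all of `range n`: fill most positions greedily, leaving out `2 * M` spaced
slots, which are filled last by Hall's theorem. -/
theorem exists_good_placement_range {M n : ℕ} (hℓ : 0 < ℓ) (hM0 : 0 < M)
    (hM : ∀ D f p, (completingPoints B (nearbyPoints ℓ D f p)).card ≤ M)
    (hB : ∀ b ∈ B, 2 ≤ b.card) (hV : Fintype.card V = n) (hn : 5 * M * ℓ ≤ n) :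
    ∃ f, IsGoodPlacement B ℓ (range n) f := by
  have hMℓ : M ≤ M * ℓ := Nat.le_mul_of_pos_right M hℓ
  have hn' : 5 * (M * ℓ) ≤ n := by rwa [← mul_assoc]
  have : Nonempty V := Fintype.card_pos_iff.1 (by omega)
  have hmulinj : Function.Injective fun i : ℕ => i * ℓ := fun i j h =>
    Nat.eq_of_mul_eq_mul_right hℓ h
  have hspaced : ∀ i j : ℕ, i * ℓ < j * ℓ → i * ℓ + ℓ ≤ j * ℓ := by
    intro i j hij
    have hlt : i < j := lt_of_mul_lt_mul_right hij (Nat.zero_le _)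
    calc i * ℓ + ℓ = (i + 1) * ℓ := by ring
      _ ≤ j * ℓ := Nat.mul_le_mul_right _ hlt
  set Q : Finset ℕ := (range (2 * M)).image fun i => i * ℓ with hQdef
  have hQcard : Q.card = 2 * M := by rw [card_image_of_injective _ hmulinj, card_range]
  have hQlt : ∀ p ∈ Q, p + ℓ ≤ 2 * M * ℓ := by
    intro p hp
    obtain ⟨i, hi, rfl⟩ := mem_image.1 hp
    exact hspaced i (2 * M) (Nat.mul_lt_mul_of_pos_right (mem_range.1 hi) hℓ)
  set D₁ : Finset ℕ := range (2 * M * ℓ) \ Q with hD₁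
  have hempty : IsGoodPlacement B ℓ ∅ (fun _ => Classical.arbitrary V) := by
    refine ⟨by simp, fun a b hb hsub => ?_⟩
    have h₁ := hB b hb
    have h₂ := card_le_card hsub
    simp at h₂
    simp [h₂] at h₁
  have hD₁card : D₁.card ≤ 2 * (M * ℓ) := by
    refine (card_le_card sdiff_subset).trans ?_
    rw [card_range, mul_assoc]
  obtain ⟨f₁, hf₁, -⟩ := hempty.exists_extension hM D₁ (disjoint_empty_left _) (by
    rw [card_empty]
    omega)
  rw [empty_union] at hf₁
  set F : ℕ → Finset V := fun p => completingPoints B (nearbyPoints ℓ D₁ f₁ p) with hF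
  set E : Finset V := univ.filter fun v =>
    v ∉ D₁.image f₁ ∧ M < (Q.filter fun p => v ∈ F p).card with hE
  have hEcard : E.card ≤ 2 * M := by
    have h := card_mul_le_card_mul (s := E) (t := Q) (m := M + 1) (n := M)
      (fun v p => v ∈ F p) (fun v hv => (mem_filter.1 hv).2.2)
      (fun p _ => (card_le_card fun v hv => (mem_filter.1 hv).2).trans (hM D₁ f₁ p))
    rw [hQcard] at h
    nlinarith
  set P : Finset ℕ := (range E.card).image fun i => (2 * M + 1 + i) * ℓ with hPdef
  have hPcard : P.card = E.card := by
    rw [card_image_of_injective, card_range]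
    intro i j h
    have := hmulinj h
    omega
  have hPge : ∀ p ∈ P, 2 * M * ℓ + ℓ ≤ p := by
    intro p hp
    obtain ⟨i, -, rfl⟩ := mem_image.1 hp
    nlinarith
  have hPlt : ∀ p ∈ P, p < n := by
    intro p hp
    obtain ⟨i, hi, rfl⟩ := mem_image.1 hp
    have hi' : 2 * M + 1 + i ≤ 4 * M := by
      have := mem_range.1 hi
      omega
    have := Nat.mul_le_mul_right ℓ hi'
    nlinarith
  have hD₁lt : ∀ p ∈ D₁, p < 2 * M * ℓ := fun p hp => mem_range.1 (mem_sdiff.1 hp).1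
  obtain ⟨e, he⟩ := P.finite_toSet.exists_bijOn_of_encard_eq (t := (E : Set V)) (by
    simp [Set.encard_coe_eq_coe_finsetCard, hPcard])
  have hf₂ := hf₁.union (P := P) (h := e)
    (by
      intro p hp q hq
      obtain ⟨i, -, rfl⟩ := mem_image.1 hp
      obtain ⟨j, -, rfl⟩ := mem_image.1 hq
      exact hspaced _ _)
    he.injOn (fun p hp => (mem_filter.1 (he.mapsTo hp)).2.1)
    (by
      intro p hp hmem
      have hnear : nearbyPoints ℓ D₁ f₁ p = ∅ := by
        rw [nearbyPoints, image_eq_empty, filter_eq_empty_iff]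
        intro q hq
        have h₁ := hD₁lt q hq
        have h₂ := hPge p hp
        omega
      rw [hnear] at hmem
      obtain ⟨-, b, hb, -, hsub⟩ := (mem_filter.1 hmem).2
      have h₁ := hB b hb
      have h₂ := card_le_card hsub
      simp at h₂
      omega)
  set f₂ : ℕ → V := fun x => if x ∈ P then e x else f₁ x with hf₂def
  have hQn : Q ⊆ range n := fun p hp => mem_range.2 (by
    have := hQlt p hp
    nlinarith)
  have hsub₂ : D₁ ∪ P ⊆ range n \ Q := by
    intro p hp
    rcases mem_union.1 hp with hp | hp
    · have h := hD₁lt p hp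
      exact mem_sdiff.2 ⟨mem_range.2 (by nlinarith), (mem_sdiff.1 hp).2⟩
    · refine mem_sdiff.2 ⟨mem_range.2 (hPlt p hp), fun hpQ => ?_⟩
      have h₁ := hQlt p hpQ
      have h₂ := hPge p hp
      omega
  have hDcard : (range n \ Q).card + 2 * M = n := by
    have h := card_sdiff_add_card_eq_card hQn
    rwa [hQcard, card_range] at h
  obtain ⟨f₃, hf₃, hf₃₂⟩ := hf₂.exists_extension hM ((range n \ Q) \ (D₁ ∪ P))
    disjoint_sdiff (by
      have h := card_sdiff_add_card_eq_card hsub₂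
      omega)
  rw [union_sdiff_of_subset hsub₂] at hf₃
  have hf₃₁ : Set.EqOn f₃ f₁ D₁ := by
    intro p hp
    rw [hf₃₂ (mem_coe.2 (mem_union_left P hp)), hf₂def]
    have hpP : p ∉ P := fun h => by
      have h₁ := hD₁lt p hp
      have h₂ := hPge p h
      omega
    simp only [if_neg hpP]
  have hEf₃ : ∀ v ∈ E, v ∈ (range n \ Q).image f₃ := by
    intro v hv
    obtain ⟨p, hp, rfl⟩ := he.surjOn hv
    refine mem_image.2 ⟨p, hsub₂ (mem_union_right _ hp), ?_⟩
    rw [hf₃₂ (mem_coe.2 (mem_union_right D₁ hp)), hf₂def]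
    exact if_pos hp
  have hD₁sub : D₁ ⊆ range n \ Q := subset_union_left.trans hsub₂
  set R : Finset V := univ \ (range n \ Q).image f₃ with hRdef
  have hRcard : R.card = 2 * M := by
    have h := card_sdiff_add_card_eq_card (subset_univ ((range n \ Q).image f₃))
    rw [← hRdef, card_image_of_injOn hf₃.1, card_univ, hV] at h
    omega
  obtain ⟨h, hinj, hh⟩ := exists_injOn_slots F hQcard hRcard (hM D₁ f₁) (by
    intro v hv
    by_contra! hcon
    refine (mem_sdiff.1 hv).2 ?_
    by_cases hvD : v ∈ D₁.image f₁
    · obtain ⟨p, hp, rfl⟩ := mem_image.1 hvD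
      exact mem_image.2 ⟨p, hD₁sub hp, hf₃₁ hp⟩
    · exact hEf₃ v (mem_filter.2 ⟨mem_univ v, hvD, hcon⟩))
  refine ⟨_, sdiff_union_of_subset hQn ▸ hf₃.union (P := Q) (h := h) ?_ hinj
    (fun p hp => (mem_sdiff.1 (hh p hp).1).2) ?_⟩
  · intro p hp q hq
    obtain ⟨i, -, rfl⟩ := mem_image.1 hp
    obtain ⟨j, -, rfl⟩ := mem_image.1 hq
    exact hspaced _ _
  · intro p hp
    rw [nearbyPoints_congr hD₁sub hf₃₁ fun q hq hqp _ => mem_sdiff.2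
      ⟨mem_range.2 (hqp.trans_le (hQlt p hp)), (mem_sdiff.1 hq).2⟩]
    exact (hh p hp).2

end

/-- for fixed `2 ≤ t < k` and `λ ≥ 1` there is a constant `C > 0`
such that every design `S_λ(t,k,n)` with `n ≥ C·ℓ^(2t)` has an `ℓ`-good
sequencing (for every `ℓ ≥ k`). -/
theorem stmt_6 (t k lam : ℕ) (ht : 2 ≤ t) (htk : t < k) (hlam : 1 ≤ lam) :
    ∃ C : ℝ, 0 < C ∧ ∀ (ℓ n : ℕ), k ≤ ℓ →
      (n : ℝ) ≥ C * (ℓ : ℝ) ^ (2 * t) →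
      ∀ (V : Type) [Fintype V] [DecidableEq V], Fintype.card V = n →
      ∀ B : Finset (Finset V),
        (∀ b ∈ B, b.card = k) →
        (∀ T : Finset V, T.card = t → (B.filter (fun b => T ⊆ b)).card = lam) →
        ∃ xs : List V, xs.Nodup ∧ (∀ v : V, v ∈ xs) ∧
          ∀ i m : ℕ, m ≤ ℓ → ∀ b ∈ B, ¬ (∀ v ∈ b, v ∈ (xs.drop i).take m) := by
  refine ⟨5 * (2 ^ t * lam), by positivity, ?_⟩
  intro ℓ n hkℓ hn V _ _ hV B hcard hB
  have hℓ : 0 < ℓ := by omega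
  have hn' : 5 * (2 ^ t * lam) * ℓ ^ (2 * t) ≤ n := by exact_mod_cast hn
  have hpow : ℓ ^ (t + 1) ≤ ℓ ^ (2 * t) := Nat.pow_le_pow_right hℓ (by omega)
  have hM : ∀ D f p, (completingPoints B (nearbyPoints ℓ D f p)).card ≤ (2 * ℓ) ^ t * lam :=
    fun D f p => (card_completingPoints_le htk hcard hB _).trans
      (Nat.mul_le_mul_right _ (Nat.pow_le_pow_left (card_nearbyPoints_le D f p) t))
  obtain ⟨f, hf⟩ := exists_good_placement_range hℓ (by positivity) hM
    (fun b hb => by rw [hcard b hb]; omega) hV (by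
      calc 5 * ((2 * ℓ) ^ t * lam) * ℓ = 5 * (2 ^ t * lam) * ℓ ^ (t + 1) := by
            rw [mul_pow, pow_succ]
            ring
        _ ≤ 5 * (2 ^ t * lam) * ℓ ^ (2 * t) := Nat.mul_le_mul_left _ hpow
        _ ≤ n := hn')
  exact hf.exists_sequencing hV
end

section
/- There exists a real constant C > 0 such that for every positive integer ℓ and every integer n with n ≥ (3/2)·ℓ⁴ + C·ℓ³, every partial Steiner triple system on a point set of cardinality n has a cyclic ℓ-good sequencing. -/
section TrianglePacking

open Finset

open scoped Classical

variable {V : Type*}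

/-- A finite family of triples, any two distinct members of which share at most one point. -/
structure IsPartialTripleSystem (B : Finset (Finset V)) : Prop where
  card_eq : ∀ b ∈ B, b.card = 3
  eq_of_mem : ∀ b ∈ B, ∀ b' ∈ B, ∀ u v : V, u ≠ v →
    u ∈ b → v ∈ b → u ∈ b' → v ∈ b' → b = b'

lemma IsPartialTripleSystem.mono {B B' : Finset (Finset V)} (hB : IsPartialTripleSystem B)
    (h : B' ⊆ B) : IsPartialTripleSystem B' :=
  ⟨fun b hb => hB.card_eq b (h hb),
    fun b hb b' hb' => hB.eq_of_mem b (h hb) b' (h hb')⟩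

lemma eq_of_mem_of_card_eq_three {b : Finset V} (hb : b.card = 3) {c d w w' : V}
    (hc : c ∈ b) (hd : d ∈ b) (hw : w ∈ b) (hw' : w' ∈ b) (hcd : c ≠ d)
    (hwc : w ≠ c) (hwd : w ≠ d) (hwc' : w' ≠ c) (hwd' : w' ≠ d) : w = w' := by
  obtain ⟨x, y, z, -, -, -, rfl⟩ := Finset.card_eq_three.1 hb
  simp only [mem_insert, mem_singleton] at hc hd hw hw'
  grind

lemma exists_other_two {b : Finset V} (hb : b.card = 3) {w : V} (hw : w ∈ b) :
    ∃ c ∈ b, ∃ d ∈ b, c ≠ d ∧ c ≠ w ∧ d ≠ w := by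
  obtain ⟨x, y, z, hxy, hxz, hyz, rfl⟩ := Finset.card_eq_three.1 hb
  simp only [mem_insert, mem_singleton] at hw
  rcases hw with rfl | rfl | rfl
  · exact ⟨y, by simp, z, by simp, hyz, hxy.symm, hxz.symm⟩
  · exact ⟨x, by simp, z, by simp, hxz, hxy, hyz.symm⟩
  · exact ⟨x, by simp, y, by simp, hxy, hxz, hyz⟩

lemma IsPartialTripleSystem.card_filter_mem_mem_le_one {B : Finset (Finset V)}
    (hB : IsPartialTripleSystem B) {u v : V} (huv : u ≠ v) :
    (B.filter fun b => u ∈ b ∧ v ∈ b).card ≤ 1 := by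
  rw [Finset.card_le_one]
  intro b hb b' hb'
  rw [mem_filter] at hb hb'
  exact hB.eq_of_mem b hb.1 b' hb'.1 u v huv hb.2.1 hb.2.2 hb'.2.1 hb'.2.2

/-- The blocks through `a` whose other two points are adjacent. -/
noncomputable def linkBlocks (B : Finset (Finset V)) (G : SimpleGraph V) (a : V) :
    Finset (Finset V) :=
  B.filter fun b => a ∈ b ∧ G.IsClique (b.erase a : Finset V)

/-- The blocks that are cliques of `G`. -/
noncomputable def cliqueBlocks (B : Finset (Finset V)) (G : SimpleGraph V) :
    Finset (Finset V) :=
  B.filter fun b => G.IsClique (b : Set V)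

lemma mem_cliqueBlocks {B : Finset (Finset V)} {G : SimpleGraph V} {b : Finset V} :
    b ∈ cliqueBlocks B G ↔ b ∈ B ∧ G.IsClique (b : Set V) :=
  mem_filter

lemma card_linkBlocks_comap_swap_le {B : Finset (Finset V)} (hB : IsPartialTripleSystem B)
    (G : SimpleGraph V) {a w x : V} (hxa : x ≠ a) (hxw : x ≠ w) :
    (linkBlocks B (G.comap (Equiv.swap a w)) x).card ≤ (linkBlocks B G x).card + 2 := by
  have hsub : linkBlocks B (G.comap (Equiv.swap a w)) x ⊆
      linkBlocks B G x ∪ ((B.filter fun b => x ∈ b ∧ a ∈ b) ∪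
        B.filter fun b => x ∈ b ∧ w ∈ b) := by
    intro b hb
    simp only [linkBlocks, mem_filter, mem_union] at hb ⊢
    obtain ⟨hb, hx, hcl⟩ := hb
    by_cases ha : a ∈ b
    · exact Or.inr (Or.inl ⟨hb, hx, ha⟩)
    by_cases hw : w ∈ b
    · exact Or.inr (Or.inr ⟨hb, hx, hw⟩)
    refine Or.inl ⟨hb, hx, ?_⟩
    intro u hu v hv huv
    have h := hcl hu hv huv
    have hu' : u ∈ b := mem_of_mem_erase (mem_coe.1 hu)
    have hv' : v ∈ b := mem_of_mem_erase (mem_coe.1 hv)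
    rwa [SimpleGraph.comap_adj,
      Equiv.swap_apply_of_ne_of_ne (ne_of_mem_of_not_mem hu' ha) (ne_of_mem_of_not_mem hu' hw),
      Equiv.swap_apply_of_ne_of_ne (ne_of_mem_of_not_mem hv' ha)
        (ne_of_mem_of_not_mem hv' hw)] at h
  have h1 := hB.card_filter_mem_mem_le_one hxa
  have h2 := hB.card_filter_mem_mem_le_one hxw
  have h3 := card_le_card hsub
  have h4 := card_union_le (linkBlocks B G x) ((B.filter fun b => x ∈ b ∧ a ∈ b) ∪
        B.filter fun b => x ∈ b ∧ w ∈ b)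
  have h5 := card_union_le (B.filter fun b => x ∈ b ∧ a ∈ b) (B.filter fun b => x ∈ b ∧ w ∈ b)
  omega

variable [Fintype V]

/-- Every vertex has at most `D` neighbours. -/
def DegreeLE (G : SimpleGraph V) (D : ℕ) : Prop :=
  ∀ v, (univ.filter fun w => G.Adj v w).card ≤ D

lemma DegreeLE.comap {G : SimpleGraph V} {D : ℕ} (hG : DegreeLE G D) (σ : Equiv.Perm V) :
    DegreeLE (G.comap σ) D := by
  intro v
  refine le_trans ?_ (hG (σ v))
  refine Finset.card_le_card_of_injOn σ ?_ σ.injective.injOn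
  intro w hw
  simpa using hw

/-- The points completing an adjacent pair of neighbours of `a` to a block. -/
noncomputable def completions (B : Finset (Finset V)) (G : SimpleGraph V) (a : V) : Finset V :=
  univ.filter fun w => ∃ b ∈ B, a ∉ b ∧ w ∈ b ∧ ∀ c ∈ b, c ≠ w → G.Adj a c

lemma card_completions_le {B : Finset (Finset V)} (hB : IsPartialTripleSystem B)
    {G : SimpleGraph V} {D : ℕ} (hG : DegreeLE G D) (a : V) :
    (completions B G a).card ≤ D * D := by
  set N := univ.filter fun w => G.Adj a w
  have hsub : completions B G a ⊆ N.offDiag.biUnion fun p =>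
      univ.filter fun w => ∃ b ∈ B, p.1 ∈ b ∧ p.2 ∈ b ∧ w ∈ b ∧ w ≠ p.1 ∧ w ≠ p.2 := by
    intro w hw
    simp only [completions, mem_filter, mem_univ, true_and] at hw
    obtain ⟨b, hb, -, hwb, h⟩ := hw
    obtain ⟨c, hc, d, hd, hcd, hcw, hdw⟩ := exists_other_two (hB.card_eq b hb) hwb
    simp only [mem_biUnion, mem_offDiag, mem_filter, mem_univ, true_and, N]
    exact ⟨(c, d), ⟨h c hc hcw, h d hd hdw, hcd⟩, b, hb, hc, hd, hwb, hcw.symm, hdw.symm⟩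
  calc _ ≤ _ := card_le_card hsub
    _ ≤ N.offDiag.card * 1 := by
        refine card_biUnion_le_card_mul _ _ _ ?_
        rintro ⟨c, d⟩ hp
        have hcd := (mem_offDiag.1 hp).2.2
        rw [Finset.card_le_one]
        intro w hw w' hw'
        simp only [mem_filter, mem_univ, true_and] at hw hw'
        obtain ⟨b, hb, hc, hd, hwb, h1, h2⟩ := hw
        obtain ⟨b', hb', hc', hd', hwb', h1', h2'⟩ := hw'
        obtain rfl := hB.eq_of_mem b hb b' hb' c d hcd hc hd hc' hd'
        exact eq_of_mem_of_card_eq_three (hB.card_eq b hb) hc hd hwb hwb' hcd h1 h2 h1' h2'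
    _ ≤ D * D := by
        rw [mul_one, offDiag_card]
        exact (Nat.sub_le _ _).trans (Nat.mul_le_mul (hG a) (hG a))

lemma sum_card_linkBlocks_le {B : Finset (Finset V)} (hB : IsPartialTripleSystem B)
    {G : SimpleGraph V} {D : ℕ} (hG : DegreeLE G D) :
    ∑ x, (linkBlocks B G x).card ≤ Fintype.card V * D := by
  rw [← Finset.card_sigma]
  set E : Finset (Σ _ : V, V) := univ.sigma fun c => univ.filter fun d => G.Adj c d
  have hE : E.card ≤ Fintype.card V * D := by
    rw [Finset.card_sigma, ← Finset.card_univ, ← smul_eq_mul]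
    exact Finset.sum_le_card_nsmul _ _ _ fun c _ => hG c
  have hsub : (univ.sigma fun x => linkBlocks B G x) ⊆ E.biUnion fun p =>
      univ.filter fun s : (Σ _ : V, Finset V) => s.2 ∈ B ∧ p.1 ∈ s.2 ∧ p.2 ∈ s.2 ∧
        s.1 ∈ s.2 ∧ s.1 ≠ p.1 ∧ s.1 ≠ p.2 := by
    rintro ⟨x, b⟩ hs
    simp only [mem_sigma, mem_univ, true_and, linkBlocks, mem_filter] at hs
    obtain ⟨hb, hx, hcl⟩ := hs
    obtain ⟨c, hc, d, hd, hcd, hcx, hdx⟩ := exists_other_two (hB.card_eq b hb) hx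
    simp only [mem_biUnion, mem_sigma, mem_filter, mem_univ, true_and, E]
    exact ⟨⟨c, d⟩, hcl (by simp [hc, hcx]) (by simp [hd, hdx]) hcd, hb, hc, hd, hx,
      hcx.symm, hdx.symm⟩
  calc _ ≤ _ := card_le_card hsub
    _ ≤ E.card * 1 := by
        refine card_biUnion_le_card_mul _ _ _ ?_
        rintro ⟨c, d⟩ hp
        have hcd : c ≠ d := by
          simp only [mem_sigma, mem_filter, mem_univ, true_and, E] at hp
          exact hp.ne
        rw [Finset.card_le_one]
        rintro ⟨w, b⟩ hw ⟨w', b'⟩ hw'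
        simp only [mem_filter, mem_univ, true_and] at hw hw'
        obtain ⟨hb, hc, hd, hwb, h1, h2⟩ := hw
        obtain ⟨hb', hc', hd', hwb', h1', h2'⟩ := hw'
        obtain rfl := hB.eq_of_mem b hb b' hb' c d hcd hc hd hc' hd'
        rw [eq_of_mem_of_card_eq_three (hB.card_eq b hb) hc hd hwb hwb' hcd h1 h2 h1' h2']
    _ ≤ _ := by rwa [mul_one]

/-- If `w` is neither a completion of `a` nor adjacent to `a`, then after exchanging `a` and `w`
every clique block either contains `a` but not `w`, or avoids both and was a clique before. -/
lemma mem_cliqueBlocks_comap_swap {B : Finset (Finset V)} {G : SimpleGraph V} {a w : V}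
    (hwa : w ≠ a) (hadj : ¬ G.Adj a w) (hw : w ∉ completions B G a) {b : Finset V}
    (hb : b ∈ cliqueBlocks B (G.comap (Equiv.swap a w))) :
    w ∉ b ∧ (a ∉ b → b ∈ cliqueBlocks B G) ∧ (a ∈ b → ∀ c ∈ b, c ≠ a → G.Adj w c) := by
  simp only [cliqueBlocks, mem_filter] at hb
  obtain ⟨hb, hcl⟩ := hb
  have key : ∀ u ∈ b, ∀ v ∈ b, u ≠ v → G.Adj (Equiv.swap a w u) (Equiv.swap a w v) :=
    fun u hu v hv huv => hcl hu hv huv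
  have hwb : w ∉ b := by
    intro hwb
    by_cases hab : a ∈ b
    · have := key a hab w hwb hwa.symm
      rw [Equiv.swap_apply_left, Equiv.swap_apply_right] at this
      exact hadj this.symm
    · refine hw ?_
      simp only [completions, mem_filter, mem_univ, true_and]
      refine ⟨b, hb, hab, hwb, fun c hc hcw => ?_⟩
      have := key w hwb c hc hcw.symm
      rwa [Equiv.swap_apply_right,
        Equiv.swap_apply_of_ne_of_ne (ne_of_mem_of_not_mem hc hab) hcw] at this
  refine ⟨hwb, fun hab => ?_, fun hab c hc hca => ?_⟩
  · simp only [cliqueBlocks, mem_filter]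
    refine ⟨hb, fun u hu v hv huv => ?_⟩
    have := key u hu v hv huv
    rw [mem_coe] at hu hv
    rwa [
      Equiv.swap_apply_of_ne_of_ne (ne_of_mem_of_not_mem hu hab) (ne_of_mem_of_not_mem hu hwb),
      Equiv.swap_apply_of_ne_of_ne (ne_of_mem_of_not_mem hv hab)
        (ne_of_mem_of_not_mem hv hwb)] at this
  · have := key a hab c hc hca.symm
    rwa [Equiv.swap_apply_left,
      Equiv.swap_apply_of_ne_of_ne hca (ne_of_mem_of_not_mem hc hwb)] at this

/-- A vertex with few link blocks can be exchanged so that it leaves all clique blocks and no new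
clique block arises. -/
lemma exists_swap_cliqueBlocks {B : Finset (Finset V)} (hB : IsPartialTripleSystem B)
    {G : SimpleGraph V} {D : ℕ} (hG : DegreeLE G D) (a : V)
    (hcard : (linkBlocks B G a).card * D + D * D + D + 1 < Fintype.card V) :
    ∃ w, ∀ b ∈ cliqueBlocks B (G.comap (Equiv.swap a w)),
      b ∈ cliqueBlocks B G ∧ a ∉ b ∧ w ∉ b := by
  set X := (linkBlocks B G a).biUnion fun b => univ.filter fun w => ∀ c ∈ b, c ≠ a → G.Adj w c
  have hX : X.card ≤ (linkBlocks B G a).card * D := by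
    refine card_biUnion_le_card_mul _ _ _ fun b hb => ?_
    simp only [linkBlocks, mem_filter] at hb
    obtain ⟨c, hc, -, -, -, hca, -⟩ := exists_other_two (hB.card_eq b hb.1) hb.2.1
    refine le_trans (card_le_card fun w hw => ?_) (hG c)
    simp only [mem_filter, mem_univ, true_and] at hw ⊢
    exact (hw c hc hca).symm
  have hlt : (X ∪ (completions B G a ∪ insert a (univ.filter fun w => G.Adj a w))).card <
      (univ : Finset V).card := by
    have h1 := card_union_le X (completions B G a ∪ insert a (univ.filter fun w => G.Adj a w))
    have h2 := card_union_le (completions B G a) (insert a (univ.filter fun w => G.Adj a w))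
    have h3 := card_insert_le a (univ.filter fun w => G.Adj a w)
    have h4 := card_completions_le hB hG a
    have h5 := hG a
    rw [card_univ]
    omega
  obtain ⟨w, -, hw⟩ := exists_mem_notMem_of_card_lt_card hlt
  simp only [mem_union, mem_insert, mem_filter, mem_univ, true_and, not_or] at hw
  obtain ⟨hwX, hwc, hwa, hadj⟩ := hw
  refine ⟨w, fun b hb => ?_⟩
  obtain ⟨hwb, hout, hin⟩ := mem_cliqueBlocks_comap_swap hwa hadj hwc hb
  have hab : a ∉ b := by
    intro hab
    refine hwX (mem_biUnion.2 ⟨b, ?_, by simpa using hin hab⟩)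
    simp only [linkBlocks, cliqueBlocks, mem_filter] at hb ⊢
    refine ⟨hb.1, hab, fun u hu v hv huv => ?_⟩
    have hu' := mem_erase.1 (mem_coe.1 hu)
    have hv' := mem_erase.1 (mem_coe.1 hv)
    have := hb.2 (mem_coe.2 hu'.2) (mem_coe.2 hv'.2) huv
    rwa [SimpleGraph.comap_adj,
      Equiv.swap_apply_of_ne_of_ne hu'.1 (ne_of_mem_of_not_mem hu'.2 hwb),
      Equiv.swap_apply_of_ne_of_ne hv'.1 (ne_of_mem_of_not_mem hv'.2 hwb)] at this
  exact ⟨hout hab, hab, hwb⟩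

lemma exists_perm_cliqueBlocks_eq_empty_of_light {B : Finset (Finset V)}
    (hB : IsPartialTripleSystem B) {D T : ℕ} (hcard : T * D + D * D + D + 1 < Fintype.card V)
    (k : ℕ) : ∀ G : SimpleGraph V, DegreeLE G D → (cliqueBlocks B G).card ≤ k →
      (∀ b ∈ cliqueBlocks B G, ∃ a ∈ b, (linkBlocks B G a).card + 2 * k ≤ T) →
      ∃ σ : Equiv.Perm V, cliqueBlocks B (G.comap σ) = ∅ := by
  induction k with
  | zero =>
    intro G _ h0 _
    refine ⟨1, ?_⟩
    simpa using h0
  | succ k ih =>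
    intro G hG hk hlight
    rcases (cliqueBlocks B G).eq_empty_or_nonempty with h0 | ⟨b, hb⟩
    · exact ⟨1, by simpa using h0⟩
    obtain ⟨a, hab, ha⟩ := hlight b hb
    have hT : (linkBlocks B G a).card * D ≤ T * D := Nat.mul_le_mul_right _ (by omega)
    obtain ⟨w, hw⟩ := exists_swap_cliqueBlocks hB hG a (by omega)
    suffices h : ∃ τ : Equiv.Perm V,
        cliqueBlocks B ((G.comap (Equiv.swap a w)).comap τ) = ∅ by
      obtain ⟨τ, hτ⟩ := h
      refine ⟨τ.trans (Equiv.swap a w), ?_⟩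
      rwa [SimpleGraph.comap_comap] at hτ
    refine ih (G.comap (Equiv.swap a w)) (hG.comap _) ?_ ?_
    · have hlt : (cliqueBlocks B (G.comap (Equiv.swap a w))).card < (cliqueBlocks B G).card := by
        refine card_lt_card (ssubset_iff_of_subset (fun c hc => (hw c hc).1) |>.2 ⟨b, hb, ?_⟩)
        exact fun h => (hw b h).2.1 hab
      omega
    · intro c hc
      obtain ⟨hcG, hac, hwc⟩ := hw c hc
      obtain ⟨x, hx, hxT⟩ := hlight c hcG
      have := card_linkBlocks_comap_swap_le hB G (ne_of_mem_of_not_mem hx hac)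
        (ne_of_mem_of_not_mem hx hwc)
      exact ⟨x, hx, by omega⟩

lemma exists_perm_cliqueBlocks_eq_empty_of_forall_mem {B : Finset (Finset V)}
    (hB : IsPartialTripleSystem B) {D : ℕ} (hD : 0 < D)
    (hcard : 10 * D ^ 3 ≤ Fintype.card V) {G : SimpleGraph V} (hG : DegreeLE G D) (z : V)
    (hz : ∀ b ∈ cliqueBlocks B G, z ∈ b) :
    ∃ σ : Equiv.Perm V, cliqueBlocks B (G.comap σ) = ∅ := by
  have hD2 : D ≤ D ^ 2 := Nat.le_self_pow (by norm_num) D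
  have hD3 : D ^ 2 ≤ D ^ 3 := Nat.pow_le_pow_right hD (by norm_num)
  set H := univ.filter fun x => 2 * D ^ 2 < (linkBlocks B G x).card
  have hH : 2 * (H.card * D) ≤ Fintype.card V := by
    have h1 : H.card * (2 * D ^ 2) ≤ ∑ x ∈ H, (linkBlocks B G x).card := by
      rw [← smul_eq_mul]
      exact Finset.card_nsmul_le_sum _ _ _ fun x hx => (mem_filter.1 hx).2.le
    have h2 : ∑ x ∈ H, (linkBlocks B G x).card ≤ ∑ x, (linkBlocks B G x).card :=
      Finset.sum_le_sum_of_subset (subset_univ _)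
    have h3 := sum_card_linkBlocks_le hB hG
    refine Nat.le_of_mul_le_mul_right ?_ hD
    calc 2 * (H.card * D) * D = H.card * (2 * D ^ 2) := by ring
      _ ≤ _ := h1.trans (h2.trans h3)
  set X := H.biUnion fun x => univ.filter fun q => G.Adj x q
  have hX : X.card ≤ H.card * D := card_biUnion_le_card_mul _ _ _ fun x _ => hG x
  have hlt : (X ∪ (completions B G z ∪ insert z (univ.filter fun w => G.Adj z w))).card <
      (univ : Finset V).card := by
    have h1 := card_union_le X (completions B G z ∪ insert z (univ.filter fun w => G.Adj z w))
    have h2 := card_union_le (completions B G z) (insert z (univ.filter fun w => G.Adj z w))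
    have h3 := card_insert_le z (univ.filter fun w => G.Adj z w)
    have h4 := card_completions_le hB hG z
    have h5 := hG z
    rw [← sq] at h4
    rw [card_univ]
    omega
  obtain ⟨q, -, hq⟩ := exists_mem_notMem_of_card_lt_card hlt
  simp only [mem_union, mem_insert, mem_filter, mem_univ, true_and, not_or] at hq
  obtain ⟨hqX, hqc, hqz, hadj⟩ := hq
  have hnew : ∀ b ∈ cliqueBlocks B (G.comap (Equiv.swap z q)),
      q ∉ b ∧ z ∈ b ∧ ∀ c ∈ b, c ≠ z → G.Adj q c := by
    intro b hb
    obtain ⟨hqb, hout, hin⟩ := mem_cliqueBlocks_comap_swap hqz hadj hqc hb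
    have hzb : z ∈ b := by
      by_contra hzb
      exact hzb (hz b (hout hzb))
    exact ⟨hqb, hzb, hin hzb⟩
  have hlight : ∀ c, G.Adj q c → (linkBlocks B G c).card ≤ 2 * D ^ 2 := by
    intro c hc
    by_contra hlt
    exact hqX (mem_biUnion.2 ⟨c, by simpa [H] using hlt, by simpa using hc.symm⟩)
  have hfew : (cliqueBlocks B (G.comap (Equiv.swap z q))).card ≤ D := by
    have hsub : cliqueBlocks B (G.comap (Equiv.swap z q)) ⊆
        (univ.filter fun c => G.Adj q c).biUnion fun c => B.filter fun b => z ∈ b ∧ c ∈ b := by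
      intro b hb
      obtain ⟨-, hzb, h⟩ := hnew b hb
      have hbB : b ∈ B := (mem_filter.1 hb).1
      obtain ⟨c, hc, -, -, -, hcz, -⟩ := exists_other_two (hB.card_eq b hbB) hzb
      simp only [mem_biUnion, mem_filter, mem_univ, true_and]
      exact ⟨c, h c hc hcz, hbB, hzb, hc⟩
    refine (card_le_card hsub).trans ((card_biUnion_le_card_mul _ _ 1 ?_).trans ?_)
    · intro c hc
      refine hB.card_filter_mem_mem_le_one ?_
      rintro rfl
      exact hadj (mem_filter.1 hc).2.symm
    · rw [mul_one]
      exact hG q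
  suffices h : ∃ τ : Equiv.Perm V,
      cliqueBlocks B ((G.comap (Equiv.swap z q)).comap τ) = ∅ by
    obtain ⟨τ, hτ⟩ := h
    refine ⟨τ.trans (Equiv.swap z q), ?_⟩
    rwa [SimpleGraph.comap_comap] at hτ
  refine exists_perm_cliqueBlocks_eq_empty_of_light hB
    (T := 2 * D ^ 2 + 2 + 2 * D) (D := D) ?_ D _ (hG.comap (Equiv.swap z q)) hfew ?_
  · have : (2 * D ^ 2 + 2 + 2 * D) * D + D * D + D + 1 = 2 * D ^ 3 + 3 * D ^ 2 + 3 * D + 1 := by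
      ring
    omega
  · intro b hb
    obtain ⟨hqb, hzb, h⟩ := hnew b hb
    obtain ⟨c, hc, -, -, -, hcz, -⟩ :=
      exists_other_two (hB.card_eq b (mem_filter.1 hb).1) hzb
    have h1 := hlight c (h c hc hcz)
    have h2 := card_linkBlocks_comap_swap_le hB G hcz (ne_of_mem_of_not_mem hc hqb)
    exact ⟨c, hc, by omega⟩

/-- A graph of maximum degree `D` on at least `10 D ^ 3` vertices can be relabelled so that no
block of a given partial triple system is a triangle. -/
theorem exists_perm_cliqueBlocks_eq_empty {D : ℕ} (hD : 0 < D)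
    (hcard : 10 * D ^ 3 ≤ Fintype.card V) {G : SimpleGraph V} (hG : DegreeLE G D)
    (B : Finset (Finset V)) (hB : IsPartialTripleSystem B) :
    ∃ σ : Equiv.Perm V, cliqueBlocks B (G.comap σ) = ∅ := by
  induction B using Finset.induction_on with
  | empty => exact ⟨1, rfl⟩
  | insert b₀ B _ ih =>
    obtain ⟨σ, hσ⟩ := ih (hB.mono (subset_insert _ _))
    obtain ⟨z, hz⟩ : b₀.Nonempty := by
      rw [← card_pos, hB.card_eq b₀ (mem_insert_self _ _)]
      norm_num
    have hmem : ∀ b ∈ cliqueBlocks (insert b₀ B) (G.comap σ), z ∈ b := by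
      intro b hb
      obtain ⟨hb, hcl⟩ := mem_filter.1 hb
      rcases mem_insert.1 hb with rfl | hb
      · exact hz
      · have : b ∈ cliqueBlocks B (G.comap σ) := mem_filter.2 ⟨hb, hcl⟩
        simp [hσ] at this
    obtain ⟨τ, hτ⟩ := exists_perm_cliqueBlocks_eq_empty_of_forall_mem hB hD hcard
      (hG.comap σ) z hmem
    refine ⟨τ.trans σ, ?_⟩
    rwa [SimpleGraph.comap_comap] at hτ

/-- Vertices whose labels in `ZMod n` are at cyclic distance less than `ℓ`. -/
def cyclicGraph {n : ℕ} (e : V ≃ ZMod n) (ℓ : ℕ) : SimpleGraph V :=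
  SimpleGraph.fromRel fun u v => ∃ k < ℓ, e v = e u + (k : ZMod n)

lemma degreeLE_cyclicGraph {n : ℕ} (e : V ≃ ZMod n) (ℓ : ℕ) :
    DegreeLE (cyclicGraph e ℓ) (2 * ℓ) := by
  intro v
  have hsub : (univ.filter fun w => (cyclicGraph e ℓ).Adj v w) ⊆
      (range ℓ).image (fun k : ℕ => e.symm (e v + (k : ZMod n))) ∪
        (range ℓ).image (fun k : ℕ => e.symm (e v - (k : ZMod n))) := by
    intro w hw
    simp only [cyclicGraph, mem_filter, mem_univ, true_and, SimpleGraph.fromRel_adj] at hw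
    simp only [mem_union, mem_image, mem_range]
    rcases hw.2 with ⟨k, hk, h⟩ | ⟨k, hk, h⟩
    · exact Or.inl ⟨k, hk, by rw [← h, Equiv.symm_apply_apply]⟩
    · exact Or.inr ⟨k, hk, by rw [h, add_sub_cancel_right, Equiv.symm_apply_apply]⟩
  have h1 := card_le_card hsub
  have h2 := card_union_le ((range ℓ).image (fun k : ℕ => e.symm (e v + (k : ZMod n))))
    ((range ℓ).image (fun k : ℕ => e.symm (e v - (k : ZMod n))))
  have h3 := card_image_le (s := range ℓ) (f := fun k : ℕ => e.symm (e v + (k : ZMod n)))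
  have h4 := card_image_le (s := range ℓ) (f := fun k : ℕ => e.symm (e v - (k : ZMod n)))
  rw [card_range] at h3 h4
  omega

end TrianglePacking

lemma exists_eq_of_mem_take_rotate_map_range {α : Type*} {n : ℕ} (f : ZMod n → α) {i m : ℕ}
    {v : α} (hv : v ∈ ((((List.range n).map fun j : ℕ => f j).rotate i).take m)) :
    ∃ j < m, v = f ((i + j : ℕ) : ZMod n) := by
  obtain ⟨j, hj, rfl⟩ := List.mem_iff_getElem.1 hv
  refine ⟨j, (List.length_take_le _ _).trans_lt' hj, ?_⟩
  simp [List.getElem_rotate, add_comm]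

/-- there is a constant `C > 0` such that every partial Steiner
triple system on `n ≥ (3/2)·ℓ⁴ + C·ℓ³` points has a cyclic `ℓ`-good
sequencing. -/
theorem stmt_8 :
    ∃ C : ℝ, 0 < C ∧ ∀ (ℓ n : ℕ), 0 < ℓ →
      (n : ℝ) ≥ (3 / 2 : ℝ) * (ℓ : ℝ) ^ 4 + C * (ℓ : ℝ) ^ 3 →
      ∀ (V : Type) [Fintype V] [DecidableEq V], Fintype.card V = n →
      ∀ B : Set (Finset V),
        (∀ b ∈ B, b.card = 3) →
        (∀ b ∈ B, ∀ b' ∈ B, b ≠ b' → (b ∩ b').card ≤ 1) →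
        ∃ xs : List V, xs.Nodup ∧ (∀ v : V, v ∈ xs) ∧
          ∀ i m : ℕ, m ≤ ℓ → m ≤ xs.length →
            ∀ b ∈ B, ¬ (∀ v ∈ b, v ∈ (xs.rotate i).take m) := by
  refine ⟨80, by norm_num, ?_⟩
  intro ℓ n hℓ hn V _ _ hV B hB3 hB2
  have hcard : 10 * (2 * ℓ) ^ 3 ≤ n := by
    have h4 : (0 : ℝ) ≤ (ℓ : ℝ) ^ 4 := by positivity
    have : (10 * (2 * ℓ) ^ 3 : ℝ) ≤ n := by linarith
    exact_mod_cast this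
  have hn0 : 0 < n := lt_of_lt_of_le (by positivity) hcard
  have : NeZero n := ⟨hn0.ne'⟩
  have e : V ≃ ZMod n := Fintype.equivOfCardEq (by rw [hV, ZMod.card])
  have hPTS : IsPartialTripleSystem B.toFinite.toFinset := by
    refine ⟨fun b hb => hB3 b (by simpa using hb), ?_⟩
    intro b hb b' hb' u v huv hu hv hu' hv'
    by_contra hne
    have h1 := hB2 b (by simpa using hb) b' (by simpa using hb') hne
    exact huv (Finset.card_le_one.1 h1 u (by simp [hu, hu']) v (by simp [hv, hv']))
  obtain ⟨σ, hσ⟩ := exists_perm_cliqueBlocks_eq_empty (D := 2 * ℓ) (by omega)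
    (by rwa [hV]) (degreeLE_cyclicGraph e ℓ) _ hPTS
  set p : V ≃ ZMod n := σ.trans e with hp
  refine ⟨(List.range n).map fun j : ℕ => p.symm (j : ZMod n), ?_, ?_, ?_⟩
  · refine List.Nodup.map_on ?_ List.nodup_range
    intro x hx y hy hxy
    have h := p.symm.injective hxy
    rwa [ZMod.natCast_eq_natCast_iff', Nat.mod_eq_of_lt (List.mem_range.1 hx),
      Nat.mod_eq_of_lt (List.mem_range.1 hy)] at h
  · intro v
    refine List.mem_map.2 ⟨(p v).val, List.mem_range.2 (ZMod.val_lt _), ?_⟩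
    simp
  · intro i m hm _ b hb hall
    have hmem : b ∈ cliqueBlocks B.toFinite.toFinset ((cyclicGraph e ℓ).comap σ) := by
      refine mem_cliqueBlocks.2 ⟨by simpa using hb, ?_⟩
      intro u hu v hv huv
      obtain ⟨j, hj, hju⟩ := exists_eq_of_mem_take_rotate_map_range _ (hall u hu)
      obtain ⟨k, hk, hkv⟩ := exists_eq_of_mem_take_rotate_map_range _ (hall v hv)
      have hju' : e (σ u) = ((i + j : ℕ) : ZMod n) := p.symm_apply_eq.1 hju.symm |>.symm
      have hkv' : e (σ v) = ((i + k : ℕ) : ZMod n) := p.symm_apply_eq.1 hkv.symm |>.symm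
      simp only [cyclicGraph, SimpleGraph.comap_adj, SimpleGraph.fromRel_adj]
      refine ⟨σ.injective.ne huv, ?_⟩
      rcases le_total j k with hjk | hjk
      · refine Or.inl ⟨k - j, by omega, ?_⟩
        rw [hju', hkv', ← Nat.cast_add]
        congr 1
        omega
      · refine Or.inr ⟨j - k, by omega, ?_⟩
        rw [hju', hkv', ← Nat.cast_add]
        congr 1
        omega
    simp [hσ] at hmem
end

section
/- There exists a real constant C > 0 such that for every positive integer ℓ and every integer n with n ≥ (9/4)·ℓ⁴ + C·ℓ³, every partial directed triple system on a point set of cardinality n has a cyclic ℓ-good sequencing. -/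
namespace DirectedTripleSystem

open Finset

section Colouring

open scoped Classical

/-- A symmetric ternary relation on distinct points in which every pair of points is
completed by at most two points. -/
structure IsSparseTripleRel {V : Type} [Fintype V] (H : V → V → V → Prop) : Prop where
  swap_left : ∀ {x y z}, H x y z → H y x z
  swap_right : ∀ {x y z}, H x y z → H x z y
  ne : ∀ {x y z}, H x y z → x ≠ y
  card_le : ∀ a b, (univ.filter fun x => H x a b).card ≤ 2

variable {V : Type} [Fintype V] {k : ℕ}

/-- The points of colour `j` in a partial colouring. -/
noncomputable def block (f : V → Option (ZMod k)) (j : ZMod k) : Finset V :=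
  univ.filter fun v => f v = some j

/-- The points of colour `j` or `j + 1`. -/
noncomputable def window (f : V → Option (ZMod k)) (j : ZMod k) : Finset V :=
  univ.filter fun v => f v = some j ∨ f v = some (j + 1)

/-- The points without a colour. -/
noncomputable def uncoloured (f : V → Option (ZMod k)) : Finset V :=
  univ.filter fun v => f v = none

variable {f : V → Option (ZMod k)} {c : ℕ}

lemma mem_window {j : ZMod k} {v : V} :
    v ∈ window f j ↔ f v = some j ∨ f v = some (j + 1) := by
  simp [window]

lemma card_window_le (hf : ∀ j, (block f j).card ≤ c) (j : ZMod k) :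
    (window f j).card ≤ 2 * c := by
  have h : window f j ⊆ block f j ∪ block f (j + 1) := by
    intro v
    simp [window, block]
  have := (card_le_card h).trans (card_union_le _ _)
  have := hf j
  have := hf (j + 1)
  omega

lemma block_update_of_ne {y : V} (hy : f y = none) {i j : ZMod k} (hij : j ≠ i) :
    block (Function.update f y (some i)) j = block f j := by
  ext v
  by_cases hv : v = y
  · subst hv
    simp [block, hy, hij.symm]
  · simp [block, Function.update_of_ne hv]

lemma block_update_self (y : V) (i : ZMod k) :
    block (Function.update f y (some i)) i = insert y (block f i) := by
  ext v
  by_cases hv : v = y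
  · subst hv
    simp [block]
  · simp [block, hv]

lemma block_subset_update {y : V} (hy : f y = none) (i j : ZMod k) :
    block f j ⊆ block (Function.update f y (some i)) j := by
  by_cases hij : j = i
  · subst hij
    rw [block_update_self]
    exact subset_insert _ _
  · rw [block_update_of_ne hy hij]

lemma uncoloured_update (y : V) (i : ZMod k) :
    uncoloured (Function.update f y (some i)) = (uncoloured f).erase y := by
  ext v
  by_cases hv : v = y
  · subst hv
    simp [uncoloured]
  · simp [uncoloured, hv]

/-- The point `x` is in a triple with two points of the window at `j`. -/
def Completes (H : V → V → V → Prop) (f : V → Option (ZMod k)) (x : V) (j : ZMod k) : Prop :=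
  ∃ a ∈ window f j, ∃ b ∈ window f j, H x a b

/-- No window contains a triple. -/
def Good (H : V → V → V → Prop) (f : V → Option (ZMod k)) : Prop :=
  ∀ j, ∀ x ∈ window f j, ¬ Completes H f x j

variable {H : V → V → V → Prop}

lemma card_completes_le (hH : IsSparseTripleRel H) (hf : ∀ j, (block f j).card ≤ c)
    (j : ZMod k) : (univ.filter fun x => Completes H f x j).card ≤ 8 * c ^ 2 := by
  have h : (univ.filter fun x => Completes H f x j) ⊆
      (window f j ×ˢ window f j).biUnion fun p => univ.filter fun x => H x p.1 p.2 := by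
    intro x hx
    obtain ⟨a, ha, b, hb, hab⟩ := (mem_filter.1 hx).2
    simp only [mem_biUnion, mem_product, mem_filter, mem_univ, true_and]
    exact ⟨(a, b), ⟨ha, hb⟩, hab⟩
  have h1 := (card_le_card h).trans
    (card_biUnion_le_card_mul _ _ 2 fun p _ => hH.card_le p.1 p.2)
  rw [card_product] at h1
  have h2 := Nat.mul_le_mul (card_window_le hf j) (card_window_le hf j)
  nlinarith

lemma mem_window_update {y v : V} {i j : ZMod k}
    (hv : v ∈ window (Function.update f y (some i)) j) (hvy : v ≠ y) : v ∈ window f j := by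
  simpa [mem_window, Function.update_of_ne hvy] using hv

lemma eq_or_eq_of_mem_window_update {y : V} {i j : ZMod k}
    (h : y ∈ window (Function.update f y (some i)) j) : j = i ∨ j = i - 1 := by
  simp only [mem_window, Function.update_self, Option.some.injEq] at h
  rcases h with h | h
  · exact Or.inl h.symm
  · exact Or.inr (by rw [h]; ring)

lemma Completes.of_update (hH : IsSparseTripleRel H) {x y : V} {i j : ZMod k}
    (h : Completes H (Function.update f y (some i)) x j) :
    Completes H f x j ∨ ((j = i ∨ j = i - 1) ∧ ∃ a ∈ window f j, H x y a) := by
  obtain ⟨a, ha, b, hb, hab⟩ := h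
  have hne : a ≠ b := hH.ne (hH.swap_right (hH.swap_left hab))
  by_cases hay : a = y
  · subst hay
    exact Or.inr ⟨eq_or_eq_of_mem_window_update ha, b, mem_window_update hb hne.symm, hab⟩
  · by_cases hby : b = y
    · subst hby
      exact Or.inr ⟨eq_or_eq_of_mem_window_update hb, a, mem_window_update ha hne,
        hH.swap_right hab⟩
    · exact Or.inl ⟨a, mem_window_update ha hay, b, mem_window_update hb hby, hab⟩

lemma Good.update (hH : IsSparseTripleRel H) (hf : Good H f) {y : V} {i : ZMod k}
    (h0 : ¬ Completes H f y i) (h1 : ¬ Completes H f y (i - 1)) :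
    Good H (Function.update f y (some i)) := by
  intro j x hx hc
  by_cases hxy : x = y
  · subst hxy
    rcases hc.of_update hH with h | ⟨-, a, -, h⟩
    · rcases eq_or_eq_of_mem_window_update hx with rfl | rfl
      · exact h0 h
      · exact h1 h
    · exact hH.ne h rfl
  · have hx' := mem_window_update hx hxy
    rcases hc.of_update hH with h | ⟨hj, a, ha, h⟩
    · exact hf j x hx' h
    · have : Completes H f y j := ⟨x, hx', a, ha, hH.swap_left h⟩
      rcases hj with rfl | rfl
      · exact h0 this
      · exact h1 this

variable [NeZero k]

/-- The number of windows that are completed by `x`. -/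
noncomputable def load (H : V → V → V → Prop) (f : V → Option (ZMod k)) (x : V) : ℕ :=
  (univ.filter fun j => Completes H f x j).card

/-- The uncoloured points whose load is close to the maximum `k / 4` that we allow. -/
noncomputable def critical (H : V → V → V → Prop) (f : V → Option (ZMod k)) : Finset V :=
  univ.filter fun x => f x = none ∧ k < 4 * (load H f x + 2)

/-- A good partial colouring with classes of size at most `c` in which
uncoloured points have small load. -/
structure Admissible (H : V → V → V → Prop) (c : ℕ) (f : V → Option (ZMod k)) : Prop where
  good : Good H f
  load_le : ∀ x, f x = none → 4 * load H f x ≤ k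
  card_block_le : ∀ j, (block f j).card ≤ c

lemma sum_load_le (hH : IsSparseTripleRel H) (hf : ∀ j, (block f j).card ≤ c) :
    ∑ x, load H f x ≤ k * (8 * c ^ 2) := by
  have h : ∑ x, load H f x = ∑ j, (univ.filter fun x => Completes H f x j).card := by
    simp only [load, card_filter]
    exact sum_comm
  rw [h]
  calc _ ≤ ∑ _j : ZMod k, 8 * c ^ 2 := sum_le_sum fun j _ => card_completes_le hH hf j
    _ = _ := by simp [ZMod.card]

lemma card_critical_le (hH : IsSparseTripleRel H) (hf : ∀ j, (block f j).card ≤ c)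
    (hk : 16 ≤ k) : (critical H f).card ≤ 64 * c ^ 2 := by
  have h1 : (critical H f).card * k ≤ 8 * ∑ x, load H f x := by
    calc _ ≤ ∑ x ∈ critical H f, 8 * load H f x := by
          rw [← smul_eq_mul]
          refine card_nsmul_le_sum _ _ _ fun x hx => ?_
          have := (mem_filter.1 hx).2.2
          omega
      _ ≤ ∑ x, 8 * load H f x := sum_le_sum_of_subset (subset_univ _)
      _ = _ := by rw [mul_sum]
  have h2 := sum_load_le hH hf
  have h3 : (critical H f).card * k ≤ (64 * c ^ 2) * k := by nlinarith
  exact Nat.le_of_mul_le_mul_right h3 (by omega)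

lemma load_update_le (hH : IsSparseTripleRel H) (x y : V) (i : ZMod k) :
    load H (Function.update f y (some i)) x ≤ load H f x + 2 := by
  have h : (univ.filter fun j => Completes H (Function.update f y (some i)) x j) ⊆
      (univ.filter fun j => Completes H f x j) ∪ {i, i - 1} := by
    intro j hj
    simp only [mem_union, mem_filter, mem_univ, true_and, mem_insert, mem_singleton]
    exact ((mem_filter.1 hj).2.of_update hH).imp_right And.left
  exact (card_le_card h).trans ((card_union_le _ _).trans
    (Nat.add_le_add_left card_le_two _))

/-- Giving `y` the colour `i` would increase the load of a critical point. -/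
def Harms (H : V → V → V → Prop) (f : V → Option (ZMod k)) (y : V) (i : ZMod k) : Prop :=
  ∃ x ∈ critical H f, ∃ a, (a ∈ window f i ∨ a ∈ window f (i - 1)) ∧ H x y a

lemma Admissible.update (hH : IsSparseTripleRel H) (hf : Admissible H c f) {y : V} {i : ZMod k}
    (hy : f y = none) (h0 : ¬ Completes H f y i) (h1 : ¬ Completes H f y (i - 1))
    (hharm : ¬ Harms H f y i) (hcard : (block f i).card < c) :
    Admissible H c (Function.update f y (some i)) where
  good := hf.good.update hH h0 h1
  load_le x hx := by
    have hxy : x ≠ y := by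
      rintro rfl
      simp at hx
    rw [Function.update_of_ne hxy] at hx
    by_cases hc : x ∈ critical H f
    · refine le_trans (Nat.mul_le_mul_left 4 (card_le_card ?_)) (hf.load_le x hx)
      intro j hj
      simp only [mem_filter, mem_univ, true_and] at hj ⊢
      rcases hj.of_update hH with h | ⟨hj, a, ha, h⟩
      · exact h
      · refine absurd ⟨x, hc, a, ?_, h⟩ hharm
        rcases hj with rfl | rfl
        · exact Or.inl ha
        · exact Or.inr ha
    · have := load_update_le (f := f) hH x y i
      simp only [critical, mem_filter, mem_univ, true_and, not_and, not_lt] at hc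
      have := hc hx
      omega
  card_block_le j := by
    by_cases hij : j = i
    · subst hij
      rw [block_update_self]
      exact (card_insert_le _ _).trans hcard
    · rw [block_update_of_ne hy hij]
      exact hf.card_block_le j

lemma sum_card_block_add_card_uncoloured (f : V → Option (ZMod k)) :
    ∑ j, (block f j).card + (uncoloured f).card = Fintype.card V := by
  have h := card_eq_sum_card_fiberwise (s := (univ : Finset V)) (t := univ) (f := f)
    (fun _ _ => mem_coe.2 (mem_univ _))
  rw [Fintype.sum_option] at h
  rw [← card_univ, h, add_comm]
  rfl

lemma card_harms_points_le (hH : IsSparseTripleRel H) (hf : ∀ j, (block f j).card ≤ c)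
    (i : ZMod k) :
    (univ.filter fun y => Harms H f y i).card ≤ (critical H f).card * (4 * c * 2) := by
  have h : (univ.filter fun y => Harms H f y i) ⊆ (critical H f).biUnion fun x =>
      (window f i ∪ window f (i - 1)).biUnion fun a => univ.filter fun y => H y x a := by
    intro y hy
    obtain ⟨x, hx, a, ha, h⟩ := (mem_filter.1 hy).2
    simp only [mem_biUnion, mem_filter, mem_univ, true_and, mem_union]
    exact ⟨x, hx, a, ha, hH.swap_left h⟩
  refine (card_le_card h).trans (card_biUnion_le_card_mul _ _ _ fun x _ => ?_)
  refine (card_biUnion_le_card_mul _ _ 2 fun a _ => hH.card_le x a).trans ?_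
  have := card_union_le (window f i) (window f (i - 1))
  have := card_window_le hf i
  have := card_window_le hf (i - 1)
  omega

lemma card_harms_colours_le (hH : IsSparseTripleRel H) (y : V) :
    (univ.filter fun i => Harms H f y i).card ≤ (critical H f).card * (2 * 3) := by
  have h : (univ.filter fun i => Harms H f y i) ⊆ (critical H f).biUnion fun x =>
      (univ.filter fun a => H a x y).biUnion fun a =>
        (f a).elim ∅ fun b => {b, b - 1, b + 1} := by
    intro i hi
    obtain ⟨x, hx, a, ha, h⟩ := (mem_filter.1 hi).2
    simp only [mem_biUnion, mem_filter, mem_univ, true_and]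
    refine ⟨x, hx, a, hH.swap_left (hH.swap_right h), ?_⟩
    simp only [mem_window, sub_add_cancel] at ha
    rcases ha with (ha | ha) | (ha | ha) <;> simp [ha]
  refine (card_le_card h).trans (card_biUnion_le_card_mul _ _ _ fun x _ => ?_)
  refine (card_biUnion_le_card_mul _ _ 3 fun a _ => ?_).trans
    (Nat.mul_le_mul_right 3 (hH.card_le x y))
  cases f a with
  | none => simp
  | some b => exact card_le_three

lemma exists_admissible_card_block_eq (hH : IsSparseTripleRel H) {l : ℕ} (hl : 0 < l)
    (hk : 16 ≤ k) (hn : 2 * (k * l) ≤ Fintype.card V) (hn' : 1200 * l ^ 3 ≤ Fintype.card V) :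
    ∃ f : V → Option (ZMod k), Admissible H l f ∧ ∀ j, (block f j).card = l := by
  have key : ∀ m ≤ k * l, ∃ f : V → Option (ZMod k), Admissible H l f ∧
      ∑ j, (block f j).card = m := by
    intro m
    induction m with
    | zero =>
      intro _
      refine ⟨fun _ => none, ⟨?_, ?_, ?_⟩, ?_⟩ <;> simp [Good, load, Completes, window, block]
    | succ m ih =>
      intro hm
      obtain ⟨f, hf, hsum⟩ := ih (by omega)
      obtain ⟨i, hi⟩ : ∃ i, (block f i).card < l := by
        by_contra! hcon
        have := card_nsmul_le_sum univ (fun j => (block f j).card) l fun j _ => hcon j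
        simp only [card_univ, ZMod.card, smul_eq_mul] at this
        omega
      have hW := sum_card_block_add_card_uncoloured f
      have hU := card_critical_le hH hf.card_block_le hk
      have hB : ((univ.filter fun y => Completes H f y i) ∪
          (univ.filter fun y => Completes H f y (i - 1)) ∪
          (univ.filter fun y => Harms H f y i)).card < (uncoloured f).card := by
        have h1 := card_union_le ((univ.filter fun y => Completes H f y i) ∪
          (univ.filter fun y => Completes H f y (i - 1))) (univ.filter fun y => Harms H f y i)
        have h2 := card_union_le (univ.filter fun y => Completes H f y i)
          (univ.filter fun y => Completes H f y (i - 1))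
        have h3 := card_completes_le hH hf.card_block_le i
        have h4 := card_completes_le hH hf.card_block_le (i - 1)
        have h5 := card_harms_points_le hH hf.card_block_le i
        have h6 := Nat.mul_le_mul_right (4 * l * 2) hU
        have h7 : l ^ 2 ≤ l ^ 3 := Nat.pow_le_pow_right hl (by norm_num)
        have h8 : 64 * l ^ 2 * (4 * l * 2) = 512 * l ^ 3 := by ring
        omega
      obtain ⟨y, hy, hyB⟩ := exists_mem_notMem_of_card_lt_card hB
      simp only [mem_union, mem_filter, mem_univ, true_and, not_or] at hyB
      have hy0 : f y = none := (mem_filter.1 hy).2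
      refine ⟨Function.update f y (some i),
        hf.update hH hy0 hyB.1.1 hyB.1.2 hyB.2 hi, ?_⟩
      have hW' := sum_card_block_add_card_uncoloured (Function.update f y (some i))
      rw [uncoloured_update, card_erase_of_mem hy] at hW'
      have := card_pos.2 ⟨y, hy⟩
      omega
  obtain ⟨f, hf, hsum⟩ := key (k * l) le_rfl
  refine ⟨f, hf, ?_⟩
  have h := (sum_eq_sum_iff_of_le (s := univ) (f := fun j => (block f j).card)
    (g := fun _ => l) fun j _ => hf.card_block_le j).1 (by simp [hsum, ZMod.card])
  exact fun j => h j (mem_univ j)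

lemma Admissible.exists_extension (hH : IsSparseTripleRel H) {l : ℕ} (hl : 0 < l)
    (hk : 100000 * l ^ 2 ≤ k) (hn : Fintype.card V < (k + 1) * (2 * l)) :
    ∀ (r : ℕ) (f : V → Option (ZMod k)), (uncoloured f).card = r →
      Admissible H (8 * l) f → (∀ j, l ≤ (block f j).card) →
      ∃ g : V → Option (ZMod k), (uncoloured g).card = 0 ∧ Good H g ∧
        ∀ j, l ≤ (block g j).card := by
  intro r
  induction r with
  | zero => exact fun f hr hf hb => ⟨f, hr, hf.good, hb⟩
  | succ r ih =>
    intro f hr hf hb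
    obtain ⟨y, hy⟩ : (uncoloured f).Nonempty := card_pos.1 (by omega)
    have hy0 : f y = none := (mem_filter.1 hy).2
    have hl2 : 0 < l ^ 2 := by positivity
    have hU := card_critical_le hH hf.card_block_le (by omega)
    have hfull : 4 * (univ.filter fun i => 8 * l ≤ (block f i).card).card ≤ k := by
      have h1 : (univ.filter fun i => 8 * l ≤ (block f i).card).card * (8 * l) ≤
          ∑ j, (block f j).card :=
        le_trans (card_nsmul_le_sum _ _ _ fun i hi => (mem_filter.1 hi).2)
          (sum_le_sum_of_subset (subset_univ _))
      have h2 := sum_card_block_add_card_uncoloured f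
      by_contra! hcon
      have h3 := Nat.mul_le_mul_right (2 * l) (Nat.succ_le_of_lt hcon)
      simp only [Nat.succ_eq_add_one] at h3
      nlinarith
    have hprev : (univ.filter fun i => Completes H f y (i - 1)).card ≤ load H f y :=
      card_le_card_of_injOn (fun i => i - 1) (fun i hi => by simpa using hi)
        (fun a _ b _ hab => sub_left_injective hab)
    have hB : ((univ.filter fun i => 8 * l ≤ (block f i).card) ∪
        (univ.filter fun i => Completes H f y i) ∪
        (univ.filter fun i => Completes H f y (i - 1)) ∪
        (univ.filter fun i => Harms H f y i)).card < (univ : Finset (ZMod k)).card := by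
      rw [card_univ, ZMod.card]
      refine (card_union_le _ _).trans_lt ?_
      refine (Nat.add_le_add_right (card_union_le _ _) _).trans_lt ?_
      refine (Nat.add_le_add_right (Nat.add_le_add_right (card_union_le _ _) _) _).trans_lt ?_
      have h1 := card_harms_colours_le (f := f) hH y
      have h2 := hf.load_le y hy0
      have h3 : (univ.filter fun i => Completes H f y i).card = load H f y := rfl
      have h4 : 64 * (8 * l) ^ 2 = 4096 * l ^ 2 := by ring
      omega
    obtain ⟨i, -, hi⟩ := exists_mem_notMem_of_card_lt_card hB
    simp only [mem_union, mem_filter, mem_univ, true_and, not_or, not_le] at hi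
    refine ih (Function.update f y (some i)) ?_
      (hf.update hH hy0 hi.1.1.2 hi.1.2 hi.2 hi.1.1.1)
      fun j => (hb j).trans (card_le_card (block_subset_update hy0 i j))
    rw [uncoloured_update, card_erase_of_mem hy]
    omega

lemma IsSparseTripleRel.exists_colouring (hH : IsSparseTripleRel H) {l : ℕ} (hl : 0 < l)
    (hk : 100000 * l ^ 2 ≤ k) (hn : k * (2 * l) ≤ Fintype.card V)
    (hn' : Fintype.card V < (k + 1) * (2 * l)) :
    ∃ g : V → ZMod k, (∀ j, l ≤ (univ.filter fun v => g v = j).card) ∧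
      ∀ j x y z, (g x = j ∨ g x = j + 1) → (g y = j ∨ g y = j + 1) →
        (g z = j ∨ g z = j + 1) → ¬ H x y z := by
  have hl2 : 0 < l ^ 2 := by positivity
  have h3 : l ^ 3 = l ^ 2 * l := by ring
  obtain ⟨f, hf, hb⟩ := exists_admissible_card_block_eq (k := k) hH hl (by omega)
    (by linarith) (by nlinarith)
  obtain ⟨g, hg0, hg, hgb⟩ := Admissible.exists_extension hH hl hk hn' _ f rfl
    ⟨hf.good, hf.load_le, fun j => (hf.card_block_le j).trans (by omega)⟩ fun j => (hb j).ge
  have hsome : ∀ v, ∃ j, g v = some j := by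
    intro v
    have hv : v ∉ uncoloured g := by simp [card_eq_zero.1 hg0]
    simpa [uncoloured, Option.ne_none_iff_exists'] using hv
  choose g' hg' using hsome
  obtain rfl : g = fun v => some (g' v) := funext hg'
  refine ⟨g', fun j => by simpa [block] using hgb j, fun j x y z hx hy hz h => ?_⟩
  exact hg j x (by simpa [mem_window] using hx)
    ⟨y, by simpa [mem_window] using hy, z, by simpa [mem_window] using hz, h⟩

end Colouring

section Sequencing

lemma exists_forall_mem_of_infix_flatMap {α : Type*} {l : ℕ} {L : ℕ → List α}
    (hL : ∀ j, l ≤ (L j).length) {s : List α} (hs : s.length ≤ l) :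
    ∀ N start : ℕ, s <:+: (List.range' start N).flatMap L →
      ∃ j, ∀ v ∈ s, v ∈ L j ∨ v ∈ L (j + 1) := by
  intro N
  induction N with
  | zero =>
    intro start h
    have : s = [] := by simpa using h
    exact ⟨0, by simp [this]⟩
  | succ N ih =>
    intro start h
    rw [List.range'_succ, List.flatMap_cons, List.infix_append_iff] at h
    rcases h with h | h | ⟨s₁, s₂, rfl, h₁, h₂⟩
    · exact ⟨start, fun v hv => Or.inl (h.subset hv)⟩
    · exact ih _ h
    · refine ⟨start, fun v hv => (List.mem_append.1 hv).imp (fun hv => h₁.subset hv) fun hv => ?_⟩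
      cases N with
      | zero =>
        have : s₂ = [] := by simpa using h₂
        simp [this] at hv
      | succ N =>
        rw [List.range'_succ, List.flatMap_cons] at h₂
        refine (List.prefix_of_prefix_length_le h₂ (List.prefix_append _ _) ?_).subset hv
        have := hL (start + 1)
        simp only [List.length_append] at hs
        omega

lemma rotate_infix_append_self {α : Type*} (xs : List α) (i : ℕ) :
    xs.rotate i <:+: xs ++ xs := by
  rw [← List.rotate_mod]
  by_cases hx : xs = []
  · simp [hx]
  have hi : i % xs.length ≤ xs.length := (Nat.mod_lt _ (List.length_pos_iff.2 hx)).le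
  rw [List.rotate_eq_drop_append_take hi]
  refine ⟨xs.take (i % xs.length), xs.drop (i % xs.length), ?_⟩
  rw [← List.append_assoc, List.take_append_drop, List.append_assoc, List.take_append_drop]

/-- Listing the colour classes one after another yields a sequence whose short cyclic segments
meet at most two consecutive classes. -/
lemma exists_list_of_colouring {V : Type} [Fintype V] {k : ℕ} [NeZero k] {l : ℕ} (g : V → ZMod k)
    (hg : ∀ j, l ≤ (univ.filter fun v => g v = j).card) :
    ∃ xs : List V, xs.Nodup ∧ (∀ v, v ∈ xs) ∧ ∀ i m, m ≤ l →
      ∃ j, ∀ v ∈ (xs.rotate i).take m, g v = j ∨ g v = j + 1 := by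
  let L : ℕ → List V := fun j => (univ.filter fun v => g v = (j : ZMod k)).toList
  have hmem : ∀ v j, v ∈ L j ↔ g v = (j : ZMod k) := by simp [L]
  refine ⟨(List.range k).flatMap L, ?_, ?_, ?_⟩
  · rw [List.nodup_flatMap]
    refine ⟨fun j _ => nodup_toList _, ?_⟩
    refine List.nodup_range.imp_of_mem ?_
    intro a b ha hb hab v hva hvb
    rw [hmem] at hva hvb
    have := hva.symm.trans hvb
    rw [ZMod.natCast_eq_natCast_iff', Nat.mod_eq_of_lt (List.mem_range.1 ha),
      Nat.mod_eq_of_lt (List.mem_range.1 hb)] at this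
    exact hab this
  · intro v
    rw [List.mem_flatMap]
    exact ⟨(g v).val, List.mem_range.2 (ZMod.val_lt _), by simp [hmem]⟩
  · intro i m hm
    have hinf : (((List.range k).flatMap L).rotate i).take m <:+:
        (List.range' 0 (k + k)).flatMap L := by
      have h : (List.range' 0 (k + k)).flatMap L =
          (List.range k).flatMap L ++ (List.range k).flatMap L := by
        rw [← List.range_eq_range', List.range_add, List.flatMap_append, List.flatMap_map]
        simp [L]
      rw [h]
      exact (List.take_prefix _ _).isInfix.trans (rotate_infix_append_self _ _)
    obtain ⟨j, hj⟩ := exists_forall_mem_of_infix_flatMap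
      (fun j => by simpa [L] using hg j) ((List.length_take_le _ _).trans hm) _ _ hinf
    exact ⟨j, fun v hv => by simpa [hmem] using hj v hv⟩

end Sequencing

/-- The points `x`, `y`, `z` are, in some order, the points of a triple of `T`. -/
def Collinear {V : Type} (T : Set (V × V × V)) (x y z : V) : Prop :=
  ∃ t ∈ T, ({t.1, t.2.1, t.2.2} : Set V) = {x, y, z}

open scoped Classical in
lemma isSparseTripleRel_collinear {V : Type} [Fintype V] {T : Set (V × V × V)}
    (hT : ∀ t ∈ T, t.1 ≠ t.2.1 ∧ t.1 ≠ t.2.2 ∧ t.2.1 ≠ t.2.2)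
    (hT' : ∀ t ∈ T, ∀ t' ∈ T, ∀ p : V × V, p ∈ ttPairs t → p ∈ ttPairs t' → t = t') :
    IsSparseTripleRel (Collinear T) where
  swap_left := by
    rintro x y z ⟨t, ht, h⟩
    exact ⟨t, ht, h.trans (Set.insert_comm _ _ _)⟩
  swap_right := by
    rintro x y z ⟨t, ht, h⟩
    exact ⟨t, ht, h.trans (by rw [Set.pair_comm])⟩
  ne := by
    rintro x y z ⟨⟨p, q, r⟩, ht, h⟩ rfl
    obtain ⟨h1, h2, h3⟩ := hT _ ht
    simp only [Set.ext_iff, Set.mem_insert_iff, Set.mem_singleton_iff] at h h1 h2 h3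
    have hp := h p
    have hq := h q
    have hr := h r
    grind
  card_le a b := by
    have hone : ∀ p : V × V, (univ.filter fun x => ∃ t ∈ T, p ∈ ttPairs t ∧
        ({t.1, t.2.1, t.2.2} : Set V) = {x, p.1, p.2}).card ≤ 1 := by
      intro p
      rw [card_le_one]
      intro x hx y hy
      obtain ⟨t, ht, hpt, htx⟩ := (mem_filter.1 hx).2
      obtain ⟨t', ht', hpt', hty⟩ := (mem_filter.1 hy).2
      obtain rfl := hT' t ht t' ht' p hpt hpt'
      obtain ⟨u, v, w⟩ := t
      obtain ⟨h1, h2, h3⟩ := hT _ ht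
      simp only [Set.ext_iff, Set.mem_insert_iff, Set.mem_singleton_iff] at htx hty h1 h2 h3
      have := htx u
      have := htx v
      have := htx w
      have := hty u
      have := hty v
      have := hty w
      grind
    have hsub : (univ.filter fun x => Collinear T x a b) ⊆
        (univ.filter fun x => ∃ t ∈ T, (a, b) ∈ ttPairs t ∧
          ({t.1, t.2.1, t.2.2} : Set V) = {x, a, b}) ∪
        (univ.filter fun x => ∃ t ∈ T, (b, a) ∈ ttPairs t ∧
          ({t.1, t.2.1, t.2.2} : Set V) = {x, b, a}) := by
      intro x hx
      obtain ⟨t, ht, h⟩ := (mem_filter.1 hx).2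
      have hpair : (a, b) ∈ ttPairs t ∨ (b, a) ∈ ttPairs t := by
        obtain ⟨p, q, r⟩ := t
        obtain ⟨h1, h2, h3⟩ := hT _ ht
        simp only [Set.ext_iff, Set.mem_insert_iff, Set.mem_singleton_iff] at h h1 h2 h3
        simp only [ttPairs, Set.mem_insert_iff, Set.mem_singleton_iff, Prod.mk.injEq]
        have := h p
        have := h q
        have := h r
        have := h a
        have := h b
        grind
      simp only [mem_union, mem_filter, mem_univ, true_and]
      exact hpair.imp (fun hp => ⟨t, ht, hp, h⟩)
        fun hp => ⟨t, ht, hp, h.trans (by rw [Set.pair_comm])⟩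
    exact (card_le_card hsub).trans ((card_union_le _ _).trans
      (Nat.add_le_add (hone (a, b)) (hone (b, a))))

end DirectedTripleSystem

/-- there is a constant `C > 0` such that every partial directed
triple system on `n ≥ (9/4)·ℓ⁴ + C·ℓ³` points has a cyclic `ℓ`-good
sequencing. -/
theorem stmt_9 :
    ∃ C : ℝ, 0 < C ∧ ∀ (ℓ n : ℕ), 0 < ℓ →
      (n : ℝ) ≥ (9 / 4 : ℝ) * (ℓ : ℝ) ^ 4 + C * (ℓ : ℝ) ^ 3 →
      ∀ (V : Type) [Fintype V] [DecidableEq V], Fintype.card V = n →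
      ∀ T : Set (V × V × V),
        (∀ t ∈ T, t.1 ≠ t.2.1 ∧ t.1 ≠ t.2.2 ∧ t.2.1 ≠ t.2.2) →
        (∀ t ∈ T, ∀ t' ∈ T, ∀ p : V × V, p ∈ ttPairs t → p ∈ ttPairs t' → t = t') →
        ∃ xs : List V, xs.Nodup ∧ (∀ v : V, v ∈ xs) ∧
          ∀ i m : ℕ, m ≤ ℓ → m ≤ xs.length → ∀ t ∈ T,
            ¬ List.Sublist [t.1, t.2.1, t.2.2] ((xs.rotate i).take m) := by
  refine ⟨1000000, by norm_num, ?_⟩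
  intro l n hl hn V _ _ hV T hT hT'
  have hn' : 1000000 * l ^ 3 ≤ n := by
    have h : (0 : ℝ) ≤ 9 / 4 * (l : ℝ) ^ 4 := by positivity
    have : (1000000 : ℝ) * (l : ℝ) ^ 3 ≤ n := by linarith
    exact_mod_cast this
  have hl2 : 0 < l ^ 2 := by positivity
  have hk : 500000 * l ^ 2 ≤ n / (2 * l) := by
    rw [Nat.le_div_iff_mul_le (by omega)]
    calc 500000 * l ^ 2 * (2 * l) = 1000000 * l ^ 3 := by ring
      _ ≤ n := hn'
  have : NeZero (n / (2 * l)) := ⟨by omega⟩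
  obtain ⟨g, hg, hgood⟩ :=
    (DirectedTripleSystem.isSparseTripleRel_collinear hT hT').exists_colouring
      (k := n / (2 * l)) hl (by omega) (by rw [hV]; exact Nat.div_mul_le_self _ _)
      (by rw [hV, mul_comm]; exact Nat.lt_mul_div_succ _ (by omega))
  obtain ⟨xs, hnodup, hmem, hxs⟩ := DirectedTripleSystem.exists_list_of_colouring g hg
  refine ⟨xs, hnodup, hmem, fun i m hm _ t ht hsub => ?_⟩
  obtain ⟨j, hj⟩ := hxs i m hm
  exact hgood j _ _ _ (hj t.1 (hsub.subset (by simp))) (hj t.2.1 (hsub.subset (by simp)))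
    (hj t.2.2 (hsub.subset (by simp))) ⟨t, ht, rfl⟩
end
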